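/- arXiv:math/0011094 — 4 statements merged into one kernel-verified Lean document; each statement's English description precedes it below -/
import Mathlib

section
/- There exists an R-module homomorphism s : I → R such that: (i) s is injective; (ii) Ext¹_R(R/I, R) is a free R/I-module of rank one, and the class of s in Hom_R(I, R)/(R·ι) ≅ Ext¹_R(R/I, R) is a basis of it; and (iii) Hom_R(I, R) is generated as an R-module by the two elements ι and s. -/
open CategoryTheory

/-- `Ext^i_R(M, N)`, as an `R`-module, computed via projective resolutions. -/
noncomputable def extMod (R : Type) [CommRing R] (i : ℕ) (M N : ModuleCat.{0} R) :
    ModuleCat R :=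
  ((_root_.Ext R (ModuleCat.{0} R) i).obj (Opposite.op M)).obj N

/-- The depth of a local ring `A`, `inf { i | Ext^i(k, A) ≠ 0 }` where `k` is the
residue field. -/
noncomputable def ringDepth (A : Type) [CommRing A] [IsLocalRing A] : ℕ :=
  sInf {i : ℕ |
    ¬ Subsingleton (extMod A i (ModuleCat.of A (IsLocalRing.ResidueField A))
      (ModuleCat.of A A))}

/-- A Noetherian local ring `A` is Gorenstein of dimension `m` if it is Cohen--Macaulay
(depth = Krull dimension = `m`) and `Ext^m(k, A) ≅ k`. -/
def IsGorensteinLocalOfDim (A : Type) [CommRing A] [IsLocalRing A] (m : ℕ) : Prop :=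
  IsNoetherianRing A ∧ ringKrullDim A = m ∧ ringDepth A = m ∧
    Nonempty (extMod A m (ModuleCat.of A (IsLocalRing.ResidueField A)) (ModuleCat.of A A)
      ≃ₗ[A] IsLocalRing.ResidueField A)

section
variable {A : Type} [CommRing A]

/-- Postcomposition with `g`, as a map of `Hom` complexes. -/
noncomputable def linearYonedaPostcomp (K : ChainComplex (ModuleCat.{0} A) ℕ)
    {Y Z : ModuleCat.{0} A} (g : Y ⟶ Z) :
    K.linearYonedaObj A Y ⟶ K.linearYonedaObj A Z where
  f i := ((linearYoneda A (ModuleCat.{0} A)).map g).app (Opposite.op (K.X i))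
  comm' i j _ := by
    ext (f : K.X i ⟶ Y)
    change (K.d j i ≫ f) ≫ g = K.d j i ≫ f ≫ g
    simp

/-- The complex of `Hom`s into a short complex. -/
noncomputable def linearYonedaShortComplex (K : ChainComplex (ModuleCat.{0} A) ℕ)
    (S : ShortComplex (ModuleCat.{0} A)) :
    ShortComplex (CochainComplex (ModuleCat A) ℕ) :=
  ShortComplex.mk (linearYonedaPostcomp K S.f) (linearYonedaPostcomp K S.g) (by
    ext i (f : K.X i ⟶ S.X₁)
    change (f ≫ S.f) ≫ S.g = 0
    simp)

lemma linearYonedaShortComplex_shortExact (K : ChainComplex (ModuleCat.{0} A) ℕ)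
    [∀ i, Projective (K.X i)] {S : ShortComplex (ModuleCat.{0} A)} (hS : S.ShortExact) :
    (linearYonedaShortComplex K S).ShortExact := by
  apply HomologicalComplex.shortExact_of_degreewise_shortExact
  intro i
  have := hS.mono_f
  have := hS.epi_g
  refine { exact := ?_, mono_f := ?_, epi_g := ?_ }
  · rw [ShortComplex.moduleCat_exact_iff]
    intro (f : K.X i ⟶ S.X₂) (hf : f ≫ S.g = 0)
    exact ⟨hS.exact.lift f hf, hS.exact.lift_f f hf⟩
  · rw [ModuleCat.mono_iff_injective]
    intro (f : K.X i ⟶ S.X₁) (g : K.X i ⟶ S.X₁) (h : f ≫ S.f = g ≫ S.f)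
    exact (cancel_mono S.f).mp h
  · rw [ModuleCat.epi_iff_surjective]
    intro (f : K.X i ⟶ S.X₃)
    exact ⟨Projective.factorThru f S.g, Projective.factorThru_comp f S.g⟩

lemma homologyMap_linearYonedaPostcomp_smul (K : ChainComplex (ModuleCat.{0} A) ℕ)
    (Y : ModuleCat.{0} A) (x : A) (i : ℕ) :
    HomologicalComplex.homologyMap (linearYonedaPostcomp K (x • 𝟙 Y)) i = x • 𝟙 _ := by
  have : linearYonedaPostcomp K (x • 𝟙 Y) = x • 𝟙 _ := by
    ext i (f : K.X i ⟶ Y)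
    change f ≫ (x • 𝟙 Y) = x • f
    simp
  rw [this]
  have h := ShortComplex.homologyMap_smul
    (𝟙 ((K.linearYonedaObj A Y).sc i)) x
  rw [ShortComplex.homologyMap_id] at h
  exact h

lemma extMod_of_shortExact_smul {k M M' : ModuleCat.{0} A} {x : A} (g : M ⟶ M')
    (w : (x • 𝟙 M) ≫ g = 0)
    (hS : (ShortComplex.mk (x • 𝟙 M) g w).ShortExact) (i : ℕ)
    (hi : Subsingleton (extMod A i k M)) (hx : ∀ y : extMod A (i + 1) k M, x • y = 0) :
    Nonempty (extMod A i k M' ≃ₗ[A] extMod A (i + 1) k M) := by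
  let P := ProjectiveResolution.of k
  have hT := linearYonedaShortComplex_shortExact P.complex hS
  have e (j : ℕ) (Y : ModuleCat.{0} A) :
    extMod A j k Y ≅ (P.complex.linearYonedaObj A Y).homology j := P.isoExt j Y
  have hz : HomologicalComplex.homologyMap (linearYonedaShortComplex P.complex
      (ShortComplex.mk (x • 𝟙 M) g w)).f (i + 1) = 0 := by
    refine (homologyMap_linearYonedaPostcomp_smul P.complex M x (i + 1)).trans ?_
    ext y
    have h := hx ((e (i + 1) M).toLinearEquiv.symm y)
    rw [← map_smul, LinearEquiv.map_eq_zero_iff] at h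
    exact h
  have hzero : Limits.IsZero ((linearYonedaShortComplex P.complex
      (ShortComplex.mk (x • 𝟙 M) g w)).X₂.homology i) :=
    (ModuleCat.isZero_of_subsingleton _).of_iso (e i M).symm
  have hm : Mono (hT.δ i (i + 1) rfl) := hT.mono_δ i (i + 1) rfl hzero
  have he : Epi (hT.δ i (i + 1) rfl) :=
    (hT.homology_exact₁ i (i + 1) rfl).epi_f hz
  have : IsIso (hT.δ i (i + 1) rfl) := isIso_of_mono_of_epi _
  exact ⟨((e i M') ≪≫ @asIso _ _ _ _ _ this ≪≫ (e (i + 1) M).symm).toLinearEquiv⟩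

lemma nonempty_extMod_zero_equiv (k M : ModuleCat.{0} A) :
    Nonempty (extMod A 0 k M ≃ₗ[A] (k →ₗ[A] M)) := by
  let F := (linearYoneda A (ModuleCat.{0} A)).obj M
  have : Limits.PreservesFiniteLimits F := by
    have : Limits.PreservesFiniteLimits (F ⋙ forget (ModuleCat.{0} A)) :=
      inferInstanceAs (Limits.PreservesFiniteLimits (yoneda.obj M))
    exact Limits.preservesFiniteLimits_of_reflects_of_preserves F (forget _)
  have : Limits.PreservesFiniteColimits F.rightOp := Limits.preservesFiniteColimits_rightOp F
  have i : F.rightOp.leftDerived 0 ≅ F.rightOp := Functor.leftDerivedZeroIsoSelf _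
  have j : extMod A 0 k M ≅ F.obj (Opposite.op k) := (i.app k).unop.symm
  let e : (k ⟶ M) ≃ₗ[A] (k →ₗ[A] M) := ModuleCat.homLinearEquiv
  exact ⟨LinearEquiv.trans (M₂ := (k ⟶ M)) j.toLinearEquiv e⟩

end

section
open IsLocalRing
variable {R : Type*} [CommRing R]

/-- For ideals `a ≤ b`, every homomorphism `b ⧸ a → R ⧸ a` is multiplication by an element. -/
def Ideal.HomsAreMul (a b : Ideal R) : Prop :=
  ∀ f : b →ₗ[R] R ⧸ a, (∀ y : b, (y : R) ∈ a → f y = 0) →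
    ∃ c : R, ∀ y : b, f y = Ideal.Quotient.mk a (c * y)

/-- `u` generates `(a : b)` modulo `a`, and `(a : u) = b`. -/
def Ideal.IsColonGenerator (a b : Ideal R) (u : R) : Prop :=
  (∀ c, (∀ y ∈ b, c * y ∈ a) → c ∈ a ⊔ Ideal.span {u}) ∧ ∀ r, r * u ∈ a ↔ r ∈ b

lemma LinearMap.exists_comp_eq_of_ker_le {M N L : Type*} [AddCommGroup M] [AddCommGroup N]
    [AddCommGroup L] [Module R M] [Module R N] [Module R L] (p : M →ₗ[R] N)
    (hp : Function.Surjective p) (f : M →ₗ[R] L) (h : LinearMap.ker p ≤ LinearMap.ker f) :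
    ∃ g : N →ₗ[R] L, ∀ m, g (p m) = f m := by
  refine ⟨(LinearMap.ker p).liftQ f h ∘ₗ (p.quotKerEquivOfSurjective hp).symm.toLinearMap,
    fun m ↦ ?_⟩
  have : (p.quotKerEquivOfSurjective hp).symm (p m) = Submodule.Quotient.mk m := by
    rw [LinearEquiv.symm_apply_eq]; rfl
  simp [this]

lemma Ideal.exists_extend_sup_span_singleton {L : Type*} [AddCommGroup L] [Module R L]
    {b : Ideal R} (f : b →ₗ[R] L) (s : R) (v : L)
    (h : ∀ r (hr : r * s ∈ b), f ⟨r * s, hr⟩ = r • v) :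
    ∃ g : (b ⊔ Ideal.span {s} : Ideal R) →ₗ[R] L,
      ∀ (z : (b ⊔ Ideal.span {s} : Ideal R)) (y : b) (r : R), (z : R) = y + r * s →
        g z = f y + r • v := by
  let q : b × R →ₗ[R] R := b.subtype.coprod (LinearMap.toSpanSingleton R R s)
  have hq (y : b) (r : R) : q (y, r) = y + r * s := by simp [q]
  let p : b × R →ₗ[R] (b ⊔ Ideal.span {s} : Ideal R) := q.codRestrict _ (by
    rintro ⟨y, r⟩
    rw [hq]
    exact Submodule.add_mem_sup y.2 (Ideal.mem_span_singleton'.mpr ⟨r, rfl⟩))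
  have hp : Function.Surjective p := by
    rintro ⟨z, hz⟩
    obtain ⟨y, hy, t, ht, rfl⟩ := Submodule.mem_sup.mp hz
    obtain ⟨r, rfl⟩ := Ideal.mem_span_singleton'.mp ht
    exact ⟨(⟨y, hy⟩, r), Subtype.ext (hq _ _)⟩
  obtain ⟨g, hg⟩ := p.exists_comp_eq_of_ker_le hp
    (f.coprod (LinearMap.toSpanSingleton R L v)) (by
      rintro ⟨y, r⟩ hyr
      have h0 : (y : R) + r * s = 0 := (hq y r).symm.trans (congrArg Subtype.val hyr)
      have h1 : (y : R) = (-r) * s := by linear_combination h0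
      have h2 := h (-r) (h1 ▸ y.2)
      have h3 : y = ⟨(-r) * s, h1 ▸ y.2⟩ := Subtype.ext h1
      rw [LinearMap.mem_ker, LinearMap.coprod_apply, h3, h2]
      simp)
  refine ⟨g, fun z y r hz ↦ ?_⟩
  have : z = p (y, r) := Subtype.ext (hz.trans (hq y r).symm)
  rw [this, hg]
  simp

lemma Ideal.le_of_le_sup_maximalIdeal_smul [IsLocalRing R] {M : Type*} [AddCommGroup M]
    [Module R M] [IsNoetherian R M] {N K : Submodule R M}
    (h : N ≤ K ⊔ maximalIdeal R • N) : N ≤ K :=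
  Submodule.le_of_le_smul_of_le_jacobson_bot (IsNoetherian.noetherian N)
    (maximalIdeal_le_jacobson _) h

variable [IsLocalRing R]

section step
variable [IsNoetherianRing R] {a b : Ideal R} {x : R}

lemma Ideal.HomsAreMul.of_sup_span_singleton (hx : x ∈ maximalIdeal R)
    (hxa : ∀ y, x * y ∈ a → y ∈ a) (hxb : ∀ y, x * y ∈ b → y ∈ b) (hab : a ≤ b)
    (h : (a ⊔ Ideal.span {x}).HomsAreMul (b ⊔ Ideal.span {x})) : a.HomsAreMul b := by
  let a' := a ⊔ Ideal.span {x}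
  let b' := b ⊔ Ideal.span {x}
  let H : Submodule R (b →ₗ[R] R ⧸ a) :=
    { carrier := {f | ∀ y : b, (y : R) ∈ a → f y = 0}
      add_mem' := fun hf hg y hy ↦ by simp [hf y hy, hg y hy]
      zero_mem' := fun _ _ ↦ rfl
      smul_mem' := fun r f hf y hy ↦ by simp [hf y hy] }
  let ι : b →ₗ[R] R ⧸ a := a.mkQ ∘ₗ b.subtype
  suffices hH : H ≤ Submodule.span R {ι} by
    intro f hf
    obtain ⟨c, hc⟩ := Submodule.mem_span_singleton.mp (hH hf)
    exact ⟨c, fun y ↦ by rw [← hc]; rfl⟩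
  have hinj : Function.Injective (LinearMap.lsmul R (R ⧸ a) x) := by
    rw [← LinearMap.ker_eq_bot, LinearMap.ker_eq_bot']
    intro z hz
    obtain ⟨z, rfl⟩ := Ideal.Quotient.mk_surjective z
    exact Ideal.Quotient.eq_zero_iff_mem.mpr (hxa z (Ideal.Quotient.eq_zero_iff_mem.mp hz))
  have hle : a ≤ a' := le_sup_left
  have hxa' : x ∈ a' := Ideal.mem_sup_right (Ideal.mem_span_singleton_self x)
  apply Ideal.le_of_le_sup_maximalIdeal_smul
  intro f hf
  let φ : R ⧸ a →ₗ[R] R ⧸ a' := Submodule.factor hle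
  have hφ (r : R) : φ (Ideal.Quotient.mk a r) = Ideal.Quotient.mk a' r := rfl
  have hφx (z : R ⧸ a) : φ (x • z) = 0 := by
    obtain ⟨z, rfl⟩ := Ideal.Quotient.mk_surjective z
    exact Ideal.Quotient.eq_zero_iff_mem.mpr (Ideal.mul_mem_right _ _ hxa')
  obtain ⟨g, hg⟩ := Ideal.exists_extend_sup_span_singleton (φ ∘ₗ f) x 0 (fun r hr ↦ by
    have hrb : r ∈ b := hxb r (by rwa [mul_comm])
    have : (⟨r * x, hr⟩ : b) = x • ⟨r, hrb⟩ := Subtype.ext (mul_comm r x)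
    rw [LinearMap.comp_apply, this, map_smul, hφx, smul_zero])
  obtain ⟨c, hc⟩ := h g (by
    intro z hz
    obtain ⟨α, hα, t, ht, hzt⟩ := Submodule.mem_sup.mp hz
    obtain ⟨r, rfl⟩ := Ideal.mem_span_singleton'.mp ht
    rw [hg z ⟨α, hab hα⟩ r hzt.symm, LinearMap.comp_apply, hf ⟨α, hab hα⟩ hα]
    simp)
  have hfc (y : b) : (f - c • ι) y ∈ LinearMap.range (LinearMap.lsmul R (R ⧸ a) x) := by
    obtain ⟨d, hd⟩ := Ideal.Quotient.mk_surjective (f y)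
    have h1 := hc ⟨y, Ideal.mem_sup_left y.2⟩
    rw [hg _ y 0 (by simp), zero_smul, add_zero, LinearMap.comp_apply, ← hd, hφ,
      Ideal.Quotient.mk_eq_mk_iff_sub_mem] at h1
    obtain ⟨α, hα, t, ht, hαt⟩ := Submodule.mem_sup.mp h1
    obtain ⟨r, rfl⟩ := Ideal.mem_span_singleton'.mp ht
    refine ⟨Ideal.Quotient.mk a r, ?_⟩
    rw [LinearMap.sub_apply, ← hd]
    change Ideal.Quotient.mk a (x * r) = Ideal.Quotient.mk a d - Ideal.Quotient.mk a (c * y)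
    rw [← map_sub, eq_comm, Ideal.Quotient.mk_eq_mk_iff_sub_mem]
    convert hα using 1
    dsimp at hαt
    linear_combination -hαt
  let k : b →ₗ[R] R ⧸ a := (LinearEquiv.ofInjective _ hinj).symm.toLinearMap ∘ₗ
    (f - c • ι).codRestrict _ hfc
  have hk (y : b) : x • k y = (f - c • ι) y := by
    have := LinearEquiv.apply_symm_apply (LinearEquiv.ofInjective _ hinj)
      ((f - c • ι).codRestrict _ hfc y)
    exact congrArg Subtype.val this
  have hkH : k ∈ H := by
    intro y hy
    apply hinj
    rw [map_zero, LinearMap.lsmul_apply, hk, LinearMap.sub_apply, hf y hy, zero_sub, neg_eq_zero]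
    exact Ideal.Quotient.eq_zero_iff_mem.mpr (Ideal.mul_mem_left _ c hy)
  have : f = c • ι + x • k := by
    ext y
    rw [LinearMap.add_apply, LinearMap.smul_apply x k, hk]
    simp
  rw [this]
  exact Submodule.add_mem_sup (Submodule.smul_mem _ _ (Submodule.mem_span_singleton_self ι))
    (Submodule.smul_mem_smul hx hkH)

lemma Ideal.exists_isColonGenerator_of_sup_span_singleton (hx : x ∈ maximalIdeal R)
    (hxa : ∀ y, x * y ∈ a → y ∈ a) (hP : a.HomsAreMul b)
    (h : ∃ u, (a ⊔ Ideal.span {x}).IsColonGenerator (b ⊔ Ideal.span {x}) u) :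
    ∃ u, a.IsColonGenerator b u := by
  obtain ⟨v, hv1, hv2⟩ := h
  have hmem {z : R} : z ∈ a ⊔ Ideal.span {x} ↔ ∃ α ∈ a, ∃ r, z = α + r * x := by
    rw [Submodule.mem_sup]
    constructor
    · rintro ⟨α, hα, t, ht, rfl⟩
      obtain ⟨r, rfl⟩ := Ideal.mem_span_singleton'.mp ht
      exact ⟨α, hα, r, rfl⟩
    · rintro ⟨α, hα, r, rfl⟩
      exact ⟨α, hα, r * x, Ideal.mem_span_singleton'.mpr ⟨r, rfl⟩, rfl⟩
  -- correct `v` by a multiple of `x` so that it multiplies `b` into `a`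
  obtain ⟨e, he⟩ : ∃ e, ∀ y ∈ b, (v - x * e) * y ∈ a := by
    have hdiv (y : b) : ∃ r : R, v * y - r * x ∈ a := by
      obtain ⟨α, hα, r, hr⟩ := hmem.mp ((hv2 y).mpr (Ideal.mem_sup_left y.2))
      exact ⟨r, by convert hα using 1; linear_combination hr⟩
    choose g hg using hdiv
    have huniq {y r s : R} (hr : y - r * x ∈ a) (hs : y - s * x ∈ a) :
        Ideal.Quotient.mk a r = Ideal.Quotient.mk a s := by
      rw [Ideal.Quotient.mk_eq_mk_iff_sub_mem]
      apply hxa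
      convert a.sub_mem hs hr using 1
      ring
    let k : b →ₗ[R] R ⧸ a :=
      { toFun := fun y ↦ Ideal.Quotient.mk a (g y)
        map_add' := fun y z ↦ by
          rw [← map_add]
          refine huniq (hg (y + z)) ?_
          convert a.add_mem (hg y) (hg z) using 1
          push_cast
          ring
        map_smul' := fun r y ↦ by
          change _ = Ideal.Quotient.mk a (r * g y)
          refine huniq (hg (r • y)) ?_
          convert a.mul_mem_left r (hg y) using 1
          rw [Submodule.coe_smul, smul_eq_mul]
          ring }
    obtain ⟨e, he⟩ := hP k (fun y hy ↦ by
      rw [← map_zero (Ideal.Quotient.mk a)]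
      refine huniq (hg y) ?_
      simpa using a.mul_mem_left v hy)
    refine ⟨e, fun y hy ↦ ?_⟩
    have h1 : g ⟨y, hy⟩ - e * y ∈ a := Ideal.Quotient.mk_eq_mk_iff_sub_mem _ _ |>.mp (he ⟨y, hy⟩)
    convert a.add_mem (hg ⟨y, hy⟩) (a.mul_mem_left x h1) using 1
    ring
  refine ⟨v - x * e, ?_, ?_⟩
  · let K : Ideal R := a.colon b
    have hK {c : R} : c ∈ K ↔ ∀ y ∈ b, c * y ∈ a := by
      simp [K, Submodule.mem_colon]
    suffices hle : K ≤ a ⊔ Ideal.span {v - x * e} from fun c hc ↦ hle (hK.mpr hc)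
    apply Ideal.le_of_le_sup_maximalIdeal_smul
    intro c hc
    rw [hK] at hc
    have h1 : c ∈ a ⊔ Ideal.span {x} ⊔ Ideal.span {v} := by
      apply hv1
      intro z hz
      obtain ⟨β, hβ, t, ht, rfl⟩ := Submodule.mem_sup.mp hz
      obtain ⟨r, rfl⟩ := Ideal.mem_span_singleton'.mp ht
      exact hmem.mpr ⟨c * β, hc β hβ, c * r, by ring⟩
    obtain ⟨w, hw, t, ht, rfl⟩ := Submodule.mem_sup.mp h1
    obtain ⟨q, rfl⟩ := Ideal.mem_span_singleton'.mp ht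
    obtain ⟨α, hα, s, rfl⟩ := hmem.mp hw
    have hs : s + q * e ∈ K := by
      rw [hK]
      intro y hy
      apply hxa
      have h2 := a.sub_mem (a.sub_mem (hc y hy) (a.mul_mem_right y hα))
        (a.mul_mem_left q (he y hy))
      convert h2 using 1
      ring
    have : α + s * x + q * v = (α + q * (v - x * e)) + x * (s + q * e) := by ring
    rw [this]
    exact Submodule.add_mem_sup (Submodule.add_mem_sup hα (Ideal.mem_span_singleton'.mpr ⟨q, rfl⟩))
      (Submodule.smul_mem_smul hx hs)
  · intro r
    refine ⟨fun hr ↦ ?_, fun hr ↦ by rw [mul_comm]; exact he r hr⟩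
    let L : Ideal R := Submodule.comap (LinearMap.toSpanSingleton R R (v - x * e)) a
    have hL {r : R} : r ∈ L ↔ r * (v - x * e) ∈ a := Iff.rfl
    suffices hle : L ≤ b from hle (hL.mpr hr)
    apply Ideal.le_of_le_sup_maximalIdeal_smul
    intro r hr
    rw [hL] at hr
    have h1 : r ∈ b ⊔ Ideal.span {x} := (hv2 r).mp (hmem.mpr
      ⟨r * (v - x * e), hr, r * e, by ring⟩)
    obtain ⟨β, hβ, t, ht, rfl⟩ := Submodule.mem_sup.mp h1
    obtain ⟨q, rfl⟩ := Ideal.mem_span_singleton'.mp ht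
    have hq : q ∈ L := by
      rw [hL]
      apply hxa
      convert a.sub_mem hr (he β hβ) using 1
      ring
    rw [mul_comm q x]
    exact Submodule.add_mem_sup hβ (Submodule.smul_mem_smul hx hq)
end step
lemma length_linearMap_eq_add {R : Type*} [CommRing R] {M : Type*} [AddCommGroup M] [Module R M]
    (N : Submodule R M) (L : Type*) [AddCommGroup L] [Module R L] :
    Module.length R (M →ₗ[R] L) = Module.length R (M ⧸ N →ₗ[R] L) +
      Module.length R (LinearMap.range (LinearMap.lcomp R L N.subtype)) := by
  let i : (M ⧸ N →ₗ[R] L) →ₗ[R] (M →ₗ[R] L) := LinearMap.lcomp R _ N.mkQ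
  let p : (M →ₗ[R] L) →ₗ[R] (N →ₗ[R] L) := LinearMap.lcomp R _ N.subtype
  have hi : Function.Injective i := fun f g h ↦
    LinearMap.cancel_right (Submodule.mkQ_surjective N) |>.mp h
  refine Module.length_eq_add_of_exact i p.rangeRestrict hi p.surjective_rangeRestrict ?_
  intro f
  rw [Subtype.ext_iff]
  constructor
  · intro hf
    exact ⟨N.liftQ f (fun n hn ↦ LinearMap.congr_fun hf ⟨n, hn⟩), LinearMap.ext fun _ ↦ rfl⟩
  · rintro ⟨g, rfl⟩
    ext n
    change g (N.mkQ n) = 0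
    rw [(Submodule.mkQ_apply N n).trans ((Submodule.Quotient.mk_eq_zero N).mpr n.2), map_zero]

section base
variable {a b : Ideal R} {s t : R}

lemma length_linearMap_quotient_le_one (h1 : ∀ x ∈ maximalIdeal R, x * t ∈ a)
    (h2 : ∀ y, (∀ x ∈ maximalIdeal R, x * y ∈ a) → y ∈ a ⊔ Ideal.span {t})
    (M : Type*) [AddCommGroup M] [Module R M] [IsSimpleModule R M] :
    Module.length R (M →ₗ[R] R ⧸ a) ≤ 1 := by
  have := IsSimpleModule.nontrivial R M
  obtain ⟨v, hv⟩ := exists_ne (0 : M)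
  have hspan : Submodule.span R {v} = ⊤ := IsSimpleModule.span_singleton_eq_top R hv
  have hmv (x : R) (hx : x ∈ maximalIdeal R) : x • v = 0 := by
    by_contra hxv
    obtain ⟨c, hc⟩ := Submodule.mem_span_singleton.mp
      ((IsSimpleModule.span_singleton_eq_top R hxv).ge (Submodule.mem_top (x := v)))
    have hu : IsUnit (1 - c * x) :=
      IsLocalRing.isUnit_one_sub_self_of_mem_nonunits _ (Ideal.mul_mem_left _ c hx)
    apply hv
    have : (1 - c * x) • v = 0 := by rw [sub_smul, mul_smul, hc, one_smul, sub_self]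
    exact (hu.smul_eq_zero).mp this
  let N : Submodule R (R ⧸ a) := Submodule.span R {Ideal.Quotient.mk a t}
  have hN : Module.length R N ≤ 1 := by
    have : IsSimpleModule R (R ⧸ maximalIdeal R) :=
      isSimpleModule_iff_isCoatom.mpr (maximalIdeal.isMaximal R).out
    rw [← Module.length_eq_one R (R ⧸ maximalIdeal R)]
    let q : R →ₗ[R] R ⧸ a := LinearMap.toSpanSingleton R _ (Ideal.Quotient.mk a t)
    let q' : (R ⧸ maximalIdeal R) →ₗ[R] R ⧸ a := (maximalIdeal R).liftQ q (fun x hx ↦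
      Ideal.Quotient.eq_zero_iff_mem.mpr (h1 x hx))
    let q'' : (R ⧸ maximalIdeal R) →ₗ[R] N := q'.codRestrict N (fun z ↦ by
      obtain ⟨z, rfl⟩ := Ideal.Quotient.mk_surjective z
      exact Submodule.mem_span_singleton.mpr ⟨z, rfl⟩)
    refine Module.length_le_of_surjective q'' ?_
    rintro ⟨z, hz⟩
    obtain ⟨r, rfl⟩ := Submodule.mem_span_singleton.mp hz
    exact ⟨Ideal.Quotient.mk _ r, rfl⟩
  refine le_trans ?_ hN
  let ev : (M →ₗ[R] R ⧸ a) →ₗ[R] N := (LinearMap.applyₗ v).codRestrict N (fun f ↦ by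
    obtain ⟨y, hy⟩ := Ideal.Quotient.mk_surjective (f v)
    have : y ∈ a ⊔ Ideal.span {t} := h2 y (fun x hx ↦ by
      rw [← Ideal.Quotient.eq_zero_iff_mem, map_mul, hy]
      have := congrArg f (hmv x hx)
      rwa [map_smul, map_zero] at this)
    obtain ⟨α, hα, w, hw, rfl⟩ := Submodule.mem_sup.mp this
    obtain ⟨r, rfl⟩ := Ideal.mem_span_singleton'.mp hw
    refine Submodule.mem_span_singleton.mpr ⟨r, ?_⟩
    change Ideal.Quotient.mk a (r * t) = f v
    rw [← hy, eq_comm, Ideal.Quotient.mk_eq_mk_iff_sub_mem]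
    simpa using hα)
  refine Module.length_le_of_injective ev ?_
  intro f g hfg
  have hfg : f v = g v := congrArg Subtype.val hfg
  ext w
  obtain ⟨r, rfl⟩ := Submodule.mem_span_singleton.mp (hspan.ge (Submodule.mem_top (x := w)))
  rw [map_smul, map_smul, hfg]

lemma length_linearMap_quotient_le (h1 : ∀ x ∈ maximalIdeal R, x * t ∈ a)
    (h2 : ∀ y, (∀ x ∈ maximalIdeal R, x * y ∈ a) → y ∈ a ⊔ Ideal.span {t})
    {M : Type*} [AddCommGroup M] [Module R M] (hM : IsFiniteLength R M) :
    Module.length R (M →ₗ[R] R ⧸ a) ≤ Module.length R M := by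
  induction hM with
  | of_subsingleton => simp
  | @of_simple_quotient M _ _ N _ hN ih =>
    rw [length_linearMap_eq_add N (R ⧸ a),
      Module.length_eq_add_of_exact N.subtype N.mkQ (Submodule.subtype_injective _)
        (Submodule.mkQ_surjective _) (LinearMap.exact_subtype_mkQ N), add_comm,
      Module.length_eq_one R (M ⧸ N)]
    exact add_le_add ((Module.length_le_of_injective _ (Submodule.subtype_injective _)).trans ih)
      (length_linearMap_quotient_le_one h1 h2 _)

lemma exists_eq_smul_of_isFiniteLength (h1 : ∀ x ∈ maximalIdeal R, x * t ∈ a)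
    (h2 : ∀ y, (∀ x ∈ maximalIdeal R, x * y ∈ a) → y ∈ a ⊔ Ideal.span {t})
    (ha : IsFiniteLength R (R ⧸ a)) (N : Submodule R (R ⧸ a)) (f : N →ₗ[R] R ⧸ a) :
    ∃ c : R, ∀ z : N, f z = c • (z : R ⧸ a) := by
  let E := R ⧸ a
  have hNl : IsFiniteLength R N := ha.of_injective N.subtype_injective
  have hQl : IsFiniteLength R (E ⧸ N) := ha.of_surjective N.mkQ_surjective
  let p : (E →ₗ[R] E) →ₗ[R] (N →ₗ[R] E) := LinearMap.lcomp R _ N.subtype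
  have hlN := length_linearMap_quotient_le h1 h2 hNl
  have hlQ := length_linearMap_quotient_le h1 h2 hQl
  have hE : Module.length R E ≤ Module.length R (E →ₗ[R] E) := by
    refine Module.length_le_of_injective (LinearMap.mul R E) ?_
    intro y z hyz
    simpa using LinearMap.congr_fun hyz 1
  have hrange : LinearMap.range p = ⊤ := by
    by_contra hne
    have hfin : IsFiniteLength R (N →ₗ[R] E) := by
      rw [← Module.length_ne_top_iff] at hNl ⊢
      exact ne_top_of_le_ne_top hNl hlN
    obtain ⟨_, _⟩ := isFiniteLength_iff_isNoetherian_isArtinian.mp hfin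
    have h3 := Submodule.length_lt hne
    rw [length_linearMap_eq_add N E,
      Module.length_eq_add_of_exact N.subtype N.mkQ (Submodule.subtype_injective _)
        (Submodule.mkQ_surjective _) (LinearMap.exact_subtype_mkQ N), add_comm] at hE
    refine absurd hE (not_le_of_gt ?_)
    refine ENat.add_lt_add_of_le_of_lt ?_ hlQ (h3.trans_le hlN)
    rw [← Module.length_ne_top_iff] at hQl
    exact ne_top_of_le_ne_top hQl hlQ
  obtain ⟨g, rfl⟩ := hrange.ge (Submodule.mem_top (x := f))
  obtain ⟨c, hc⟩ := Ideal.Quotient.mk_surjective (g 1)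
  refine ⟨c, fun z ↦ ?_⟩
  obtain ⟨y, hy⟩ := Ideal.Quotient.mk_surjective (z : R ⧸ a)
  change g z = c • (z : R ⧸ a)
  rw [← hy]
  have : Ideal.Quotient.mk a y = y • (1 : R ⧸ a) := by
    rw [Algebra.smul_def, mul_one]; rfl
  rw [this, map_smul, ← hc]
  change Ideal.Quotient.mk a (y * c) = _ 
  rw [mul_comm, map_mul, Algebra.smul_def, Algebra.smul_def, mul_one]
  rfl

lemma Ideal.homsAreMul_of_isFiniteLength (h1 : ∀ x ∈ maximalIdeal R, x * t ∈ a)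
    (h2 : ∀ y, (∀ x ∈ maximalIdeal R, x * y ∈ a) → y ∈ a ⊔ Ideal.span {t})
    (ha : IsFiniteLength R (R ⧸ a)) (b : Ideal R) : a.HomsAreMul b := by
  intro f hf
  let q : b →ₗ[R] R ⧸ a := a.mkQ ∘ₗ b.subtype
  obtain ⟨g, hg⟩ := q.rangeRestrict.exists_comp_eq_of_ker_le q.surjective_rangeRestrict f (by
    intro y hy
    rw [LinearMap.ker_rangeRestrict] at hy
    exact hf y (Ideal.Quotient.eq_zero_iff_mem.mp hy))
  obtain ⟨c, hc⟩ := exists_eq_smul_of_isFiniteLength h1 h2 ha _ g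
  exact ⟨c, fun y ↦ by rw [← hg, hc]; rfl⟩

lemma Ideal.exists_isColonGenerator_of_isFiniteLength (ht : t ∉ a)
    (h1 : ∀ x ∈ maximalIdeal R, x * t ∈ a)
    (h2 : ∀ y, (∀ x ∈ maximalIdeal R, x * y ∈ a) → y ∈ a ⊔ Ideal.span {t})
    (ha : IsFiniteLength R (R ⧸ a)) (hab : a ≤ b)
    (hs : s ∉ b) (h1s : ∀ x ∈ maximalIdeal R, x * s ∈ b)
    (h2s : ∀ y, (∀ x ∈ maximalIdeal R, x * y ∈ b) → y ∈ b ⊔ Ideal.span {s})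
    {N : ℕ} (hN : maximalIdeal R ^ N ≤ b) :
    ∃ u, a.IsColonGenerator b u := by
  have hmem_max {c : Ideal R} {z r : R} (hz : z ∉ c) (hr : r * z ∈ c) : r ∈ maximalIdeal R := by
    rw [mem_maximalIdeal, mem_nonunits_iff]
    intro hu
    exact hz ((Ideal.unit_mul_mem_iff_mem c hu).mp hr)
  obtain ⟨g, hg⟩ := Ideal.exists_extend_sup_span_singleton (0 : b →ₗ[R] R ⧸ a) s
    (Ideal.Quotient.mk a t) (fun r hr ↦ (Ideal.Quotient.eq_zero_iff_mem.mpr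
      (h1 r (hmem_max hs hr))).symm)
  obtain ⟨u, hu⟩ := Ideal.homsAreMul_of_isFiniteLength h1 h2 ha _ g (fun z hz ↦ by
    simp [hg z ⟨z, hab hz⟩ 0 (by simp)])
  have hub (y : R) (hy : y ∈ b) : u * y ∈ a := by
    rw [← Ideal.Quotient.eq_zero_iff_mem, ← hu ⟨y, Ideal.mem_sup_left hy⟩,
      hg _ ⟨y, hy⟩ 0 (by simp)]
    simp
  have hus : u * s ∉ a := by
    rw [← Ideal.Quotient.eq_zero_iff_mem,
      ← hu ⟨s, Ideal.mem_sup_right (Ideal.mem_span_singleton_self s)⟩, hg _ 0 1 (by simp)]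
    simpa [Ideal.Quotient.eq_zero_iff_mem] using ht
  have hann (r : R) : r * u ∈ a ↔ r ∈ b := by
    refine ⟨fun hr ↦ ?_, fun hr ↦ by rw [mul_comm]; exact hub r hr⟩
    by_contra hrb
    -- a multiple of `r` lies in the socle modulo `b`
    obtain ⟨y, hyb, hyu, hym⟩ : ∃ y, y ∉ b ∧ y * u ∈ a ∧ ∀ x ∈ maximalIdeal R, x * y ∈ b := by
      by_contra! hcon
      have key (j : ℕ) : ∃ z ∈ maximalIdeal R ^ j, z * r ∉ b := by
        induction j with
        | zero => exact ⟨1, by simp, by simpa⟩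
        | succ j ih =>
          obtain ⟨z, hz, hzr⟩ := ih
          obtain ⟨x, hx, hxz⟩ := hcon (z * r) hzr (by
            rw [mul_assoc]; exact a.mul_mem_left z hr)
          refine ⟨x * z, ?_, by rwa [mul_assoc]⟩
          rw [pow_succ']
          exact Ideal.mul_mem_mul hx hz
      obtain ⟨z, hz, hzr⟩ := key N
      exact hzr (b.mul_mem_right r (hN hz))
    obtain ⟨β, hβ, w, hw, rfl⟩ := Submodule.mem_sup.mp (h2s y hym)
    obtain ⟨ρ, rfl⟩ := Ideal.mem_span_singleton'.mp hw
    have hρ : ρ * (u * s) ∈ a := by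
      convert a.sub_mem hyu (hub β hβ) using 1
      ring
    exact hyb (b.add_mem hβ (h1s ρ (hmem_max hus hρ)))
  refine ⟨u, fun v hv ↦ ?_, hann⟩
  obtain ⟨g, hg⟩ := Ideal.exists_extend_sup_span_singleton (0 : a →ₗ[R] R ⧸ a) u
    (Ideal.Quotient.mk a v) (fun r hr ↦ (Ideal.Quotient.eq_zero_iff_mem.mpr (by
      change r * v ∈ a
      rw [mul_comm]
      exact hv r ((hann r).mp hr))).symm)
  obtain ⟨c, hc⟩ := Ideal.homsAreMul_of_isFiniteLength h1 h2 ha _ g (fun z hz ↦ by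
    simp [hg z ⟨z, hz⟩ 0 (by simp)])
  have := hc ⟨u, Ideal.mem_sup_right (Ideal.mem_span_singleton_self u)⟩
  rw [hg _ 0 1 (by simp), LinearMap.zero_apply, zero_add, one_smul,
    Ideal.Quotient.mk_eq_mk_iff_sub_mem] at this
  rw [← sub_add_cancel v (c * u)]
  exact Submodule.add_mem_sup this (Ideal.mem_span_singleton'.mpr ⟨c, rfl⟩)
end base
end

section
open IsLocalRing
variable {R : Type*} [CommRing R]

lemma Ideal.isSMulRegular_quotient_iff {a : Ideal R} {x : R} :
    IsSMulRegular (R ⧸ a) x ↔ ∀ y, x * y ∈ a → y ∈ a := by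
  rw [isSMulRegular_iff_right_eq_zero_of_smul]
  constructor
  · intro h y hy
    rw [← Ideal.Quotient.eq_zero_iff_mem]
    apply h
    rw [← Ideal.Quotient.mk_eq_mk, ← Submodule.Quotient.mk_smul, Ideal.Quotient.mk_eq_mk,
      Ideal.Quotient.eq_zero_iff_mem]
    exact hy
  · intro h y hy
    obtain ⟨y, rfl⟩ := Ideal.Quotient.mk_surjective y
    rw [← Ideal.Quotient.mk_eq_mk, ← Submodule.Quotient.mk_smul, Ideal.Quotient.mk_eq_mk,
      Ideal.Quotient.eq_zero_iff_mem] at hy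
    exact Ideal.Quotient.eq_zero_iff_mem.mpr (h y hy)

lemma Ideal.ringKrullDim_quotient_sup_span_singleton [IsNoetherianRing R] [IsLocalRing R]
    {a : Ideal R} (ha : a ≠ ⊤) {x : R} (hx : x ∈ maximalIdeal R)
    (hxa : ∀ y, x * y ∈ a → y ∈ a) :
    ringKrullDim (R ⧸ (a ⊔ Ideal.span {x})) + 1 = ringKrullDim (R ⧸ a) := by
  have : Nontrivial (R ⧸ a) := Ideal.Quotient.nontrivial_iff.mpr ha
  have : IsLocalRing (R ⧸ a) :=
    IsLocalRing.of_surjective' (Ideal.Quotient.mk a) Ideal.Quotient.mk_surjective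
  have h1 : IsSMulRegular (R ⧸ a) (Ideal.Quotient.mk a x) := by
    intro y z h
    exact Ideal.isSMulRegular_quotient_iff.mpr hxa (by simpa [Algebra.smul_def] using h)
  have h2 : Ideal.Quotient.mk a x ∈ maximalIdeal (R ⧸ a) := by
    have : IsLocalHom (Ideal.Quotient.mk a) :=
      IsLocalHom.of_surjective _ Ideal.Quotient.mk_surjective
    rw [IsLocalRing.mem_maximalIdeal] at hx ⊢
    exact fun h ↦ hx (isUnit_of_map_unit _ _ h)
  rw [← ringKrullDim_quotient_span_singleton_succ_eq_ringKrullDim h1 h2]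
  congr 1
  refine ringKrullDim_eq_of_ringEquiv ((DoubleQuot.quotQuotEquivQuotSup a _).symm.trans
    (Ideal.quotEquivOfEq ?_))
  rw [Ideal.map_span, Set.image_singleton]

lemma Ideal.ringKrullDim_quotient_sup_span_singleton_eq [IsNoetherianRing R] [IsLocalRing R]
    {a : Ideal R} {x : R} (hx : x ∈ maximalIdeal R)
    (hxa : ∀ y, x * y ∈ a → y ∈ a) {d : ℕ} (hd : ringKrullDim (R ⧸ a) = (d + 1 : ℕ)) :
    ringKrullDim (R ⧸ (a ⊔ Ideal.span {x})) = d := by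
  have ha : a ≠ ⊤ := by
    rintro rfl
    have : Subsingleton (R ⧸ (⊤ : Ideal R)) := Ideal.Quotient.subsingleton_iff.mpr rfl
    rw [ringKrullDim_eq_bot_of_subsingleton] at hd
    exact absurd hd.symm (WithBot.coe_ne_bot (a := ((d + 1 : ℕ) : ℕ∞)))
  have h := Ideal.ringKrullDim_quotient_sup_span_singleton ha hx hxa
  rw [hd] at h
  generalize ringKrullDim (R ⧸ (a ⊔ Ideal.span {x})) = e at h
  induction e using WithBot.recBotCoe with
  | bot => exact absurd h.symm (WithBot.coe_ne_bot (a := ((d + 1 : ℕ) : ℕ∞)))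
  | coe e =>
    have h' : e + 1 = (d : ℕ∞) + 1 := by exact_mod_cast h
    have : e = d := ENat.add_left_injective_of_ne_top (by simp) h'
    rw [this]; rfl

/-- The ideal `a` of a local ring has no socle element outside itself. -/
def Ideal.HasNoSocle [IsLocalRing R] (a : Ideal R) : Prop :=
  ∀ y, (∀ x ∈ maximalIdeal R, x * y ∈ a) → y ∈ a

/-- The elementary content of `R ⧸ a` being Cohen–Macaulay of dimension `d` and type one: along
every regular sequence of length `d` the quotient has a one-dimensional socle. -/
def Ideal.IsTypeOne [IsLocalRing R] : ℕ → Ideal R → Prop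
  | 0, a => ∃ t ∉ a, (∀ x ∈ maximalIdeal R, x * t ∈ a) ∧
      ∀ y, (∀ x ∈ maximalIdeal R, x * y ∈ a) → y ∈ a ⊔ Ideal.span {t}
  | d + 1, a => a.HasNoSocle ∧
      ∀ x ∈ maximalIdeal R, (∀ y, x * y ∈ a → y ∈ a) → IsTypeOne d (a ⊔ Ideal.span {x})

lemma Ideal.HasNoSocle.exists_regular [IsNoetherianRing R] [IsLocalRing R] {a b : Ideal R}
    (ha : a.HasNoSocle) (hb : b.HasNoSocle) :
    ∃ x ∈ maximalIdeal R, (∀ y, x * y ∈ a → y ∈ a) ∧ ∀ y, x * y ∈ b → y ∈ b := by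
  have hom {c : Ideal R} (hc : c.HasNoSocle) (f : (R ⧸ maximalIdeal R) →ₗ[R] R ⧸ c) : f = 0 := by
    obtain ⟨y, hy⟩ := Ideal.Quotient.mk_surjective (f 1)
    have h1 : f 1 = 0 := by
      rw [← hy, Ideal.Quotient.eq_zero_iff_mem]
      refine hc y fun x hx ↦ ?_
      rw [← Ideal.Quotient.eq_zero_iff_mem, map_mul, hy]
      have : x • (1 : R ⧸ maximalIdeal R) = 0 := by
        rw [Algebra.smul_def, mul_one]
        exact Ideal.Quotient.eq_zero_iff_mem.mpr hx
      have := congrArg f this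
      rwa [map_smul, map_zero, Algebra.smul_def] at this
    ext
    simpa using h1
  have : Subsingleton ((R ⧸ maximalIdeal R) →ₗ[R] (R ⧸ a) × (R ⧸ b)) := by
    refine ⟨fun f g ↦ ?_⟩
    have h1 := (hom ha (.fst R _ _ ∘ₗ f)).trans (hom ha (.fst R _ _ ∘ₗ g)).symm
    have h2 := (hom hb (.snd R _ _ ∘ₗ f)).trans (hom hb (.snd R _ _ ∘ₗ g)).symm
    exact LinearMap.ext fun z ↦ Prod.ext (LinearMap.congr_fun h1 z) (LinearMap.congr_fun h2 z)
  obtain ⟨x, hx, hreg⟩ := IsSMulRegular.subsingleton_linearMap_iff.mp this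
  rw [Ideal.annihilator_quotient] at hx
  refine ⟨x, hx, Ideal.isSMulRegular_quotient_iff.mp fun y z h ↦ ?_,
    Ideal.isSMulRegular_quotient_iff.mp fun y z h ↦ ?_⟩
  · exact congrArg Prod.fst (@hreg (y, 0) (z, 0) (Prod.ext h (by simp)))
  · exact congrArg Prod.snd (@hreg (0, y) (0, z) (Prod.ext (by simp) h))

lemma Ideal.isArtinianRing_quotient_of_ringKrullDim_eq_zero [IsNoetherianRing R]
    {a : Ideal R} (h : ringKrullDim (R ⧸ a) = 0) : IsArtinianRing (R ⧸ a) :=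
  isArtinianRing_iff_krullDimLE_zero.mpr (Ring.krullDimLE_iff.mpr h.le)

lemma Ideal.isFiniteLength_quotient_of_ringKrullDim_eq_zero [IsNoetherianRing R]
    {a : Ideal R} (h : ringKrullDim (R ⧸ a) = 0) : IsFiniteLength R (R ⧸ a) := by
  have := Ideal.isArtinianRing_quotient_of_ringKrullDim_eq_zero h
  exact isFiniteLength_iff_isNoetherian_isArtinian.mpr
    ⟨inferInstance, isArtinian_of_surjective_algebraMap (Ideal.Quotient.mk_surjective (I := a))⟩

lemma Ideal.IsTypeOne.homsAreMul_and_exists_isColonGenerator [IsNoetherianRing R] [IsLocalRing R]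
    {d : ℕ} {a b : Ideal R} (hab : a ≤ b) (ha : a.IsTypeOne d) (hb : b.IsTypeOne d)
    (hda : ringKrullDim (R ⧸ a) = d) (hdb : ringKrullDim (R ⧸ b) = d) :
    a.HomsAreMul b ∧ ∃ u, a.IsColonGenerator b u := by
  induction d generalizing a b with
  | zero =>
    obtain ⟨t, ht, h1, h2⟩ := ha
    obtain ⟨s, hs, h1s, h2s⟩ := hb
    have hfa := Ideal.isFiniteLength_quotient_of_ringKrullDim_eq_zero (by simpa using hda)
    have := Ideal.isArtinianRing_quotient_of_ringKrullDim_eq_zero (a := b) (by simpa using hdb)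
    obtain ⟨N, hN⟩ := IsLocalRing.exists_maximalIdeal_pow_le_of_isArtinianRing_quotient b
    exact ⟨Ideal.homsAreMul_of_isFiniteLength h1 h2 hfa b,
      Ideal.exists_isColonGenerator_of_isFiniteLength ht h1 h2 hfa hab hs h1s h2s hN⟩
  | succ d ih =>
    obtain ⟨x, hx, hxa, hxb⟩ := ha.1.exists_regular hb.1
    obtain ⟨h1, h2⟩ := ih (sup_le_sup_right hab _) (ha.2 x hx hxa) (hb.2 x hx hxb)
      (Ideal.ringKrullDim_quotient_sup_span_singleton_eq hx hxa hda)
      (Ideal.ringKrullDim_quotient_sup_span_singleton_eq hx hxb hdb)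
    have h3 := Ideal.HomsAreMul.of_sup_span_singleton hx hxa hxb hab h1
    exact ⟨h3, Ideal.exists_isColonGenerator_of_sup_span_singleton hx hxa h3 h2⟩

lemma Ideal.exists_notMem_sup_span_pow [IsNoetherianRing R] [IsLocalRing R]
    {a : Ideal R} {x y : R} (hx : x ∈ maximalIdeal R) (hy : y ∉ a) :
    ∃ k, y ∉ a ⊔ Ideal.span {x ^ k} := by
  by_contra! h
  apply hy
  have hbot := Ideal.iInf_pow_smul_eq_bot_of_isLocalRing (M := R ⧸ a) (Ideal.span {x})
    fun h ↦ hx (Ideal.span_singleton_eq_top.mp h)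
  rw [← Ideal.Quotient.eq_zero_iff_mem, ← Submodule.mem_bot R, ← hbot, Submodule.mem_iInf]
  intro k
  obtain ⟨p, hp, z, hz, rfl⟩ := Submodule.mem_sup.mp (h k)
  obtain ⟨r, rfl⟩ := Ideal.mem_span_singleton'.mp hz
  rw [map_add, Ideal.Quotient.eq_zero_iff_mem.mpr hp, zero_add, mul_comm, map_mul,
    Ideal.span_singleton_pow]
  exact Submodule.smul_mem_smul (N := (⊤ : Submodule R (R ⧸ a)))
    (Ideal.mem_span_singleton_self (x ^ k)) (Submodule.mem_top (x := Ideal.Quotient.mk a r))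

lemma Ideal.mem_of_pow_mul_mem {a : Ideal R} {x : R} (hxa : ∀ y, x * y ∈ a → y ∈ a) (k : ℕ)
    {y : R} (h : x ^ k * y ∈ a) : y ∈ a := by
  induction k with
  | zero => simpa using h
  | succ k ih => exact ih (hxa _ (by rwa [← mul_assoc, ← pow_succ']))

lemma Ideal.IsTypeOne.le_ringKrullDim [IsNoetherianRing R] [IsLocalRing R]
    {d : ℕ} {a c : Ideal R} {y : R} (ha : a.IsTypeOne d) (hy : y ∉ a)
    (hc : ∀ r ∈ c, r * y ∈ a) : d ≤ ringKrullDim (R ⧸ c) := by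
  induction d generalizing a c y with
  | zero =>
    have : Nontrivial (R ⧸ c) := Ideal.Quotient.nontrivial_iff.mpr fun h ↦
      hy (by simpa using hc 1 (h ▸ Submodule.mem_top))
    exact_mod_cast ringKrullDim_nonneg_of_nontrivial
  | succ d ih =>
    obtain ⟨x, hx, hxa, -⟩ := ha.1.exists_regular ha.1
    let c' : Ideal R := Submodule.comap (LinearMap.toSpanSingleton R R y) a
    have hc' (r : R) : r ∈ c' ↔ r * y ∈ a := Iff.rfl
    have hle : c ≤ c' := hc
    refine le_trans ?_ (ringKrullDim_le_of_surjective (Ideal.Quotient.factor hle)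
      (Ideal.Quotient.factor_surjective hle))
    classical
    have hex := Ideal.exists_notMem_sup_span_pow hx hy
    obtain ⟨k, hk⟩ : ∃ k, Nat.find hex = k + 1 := by
      refine Nat.exists_eq_succ_of_ne_zero fun h0 ↦ Nat.find_spec hex ?_
      rw [h0, pow_zero, Ideal.span_singleton_one, sup_top_eq]
      exact Submodule.mem_top
    have h1 := not_not.mp (Nat.find_min hex (show k < Nat.find hex by lia))
    have h2 := hk ▸ Nat.find_spec hex
    obtain ⟨p, hp, z, hz, rfl⟩ := Submodule.mem_sup.mp h1
    obtain ⟨r, rfl⟩ := Ideal.mem_span_singleton'.mp hz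
    have hr : r ∉ a ⊔ Ideal.span {x} := by
      intro h
      obtain ⟨q, hq, z, hzx, rfl⟩ := Submodule.mem_sup.mp h
      obtain ⟨v, rfl⟩ := Ideal.mem_span_singleton'.mp hzx
      refine h2 (Submodule.mem_sup.mpr ⟨p + q * x ^ k, a.add_mem hp (a.mul_mem_right _ hq),
        v * x ^ (k + 1), Ideal.mem_span_singleton'.mpr ⟨v, rfl⟩, by ring⟩)
    have hcr (v : R) (hv : v ∈ c') : v * r ∈ a := by
      refine Ideal.mem_of_pow_mul_mem hxa k ?_
      have := a.sub_mem ((hc' v).mp hv) (a.mul_mem_left v hp)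
      convert this using 1
      ring
    have h3 := ih (ha.2 x hx hxa) hr (c := c' ⊔ Ideal.span {x}) (by
      intro v hv
      obtain ⟨q, hq, z, hz, rfl⟩ := Submodule.mem_sup.mp hv
      obtain ⟨v, rfl⟩ := Ideal.mem_span_singleton'.mp hz
      rw [add_mul]
      exact Submodule.add_mem_sup (hcr q hq) (Ideal.mem_span_singleton'.mpr ⟨v * r, by ring⟩))
    rw [← Ideal.ringKrullDim_quotient_sup_span_singleton (a := c') _ hx]
    · push_cast
      gcongr
    · intro v hv
      rw [hc'] at hv ⊢
      exact hxa _ (by rwa [← mul_assoc])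
    · intro h
      exact hy (by simpa using (hc' 1).mp (h ▸ Submodule.mem_top))

lemma Ideal.IsTypeOne.exists_regular_mem [IsNoetherianRing R] [IsLocalRing R]
    {d : ℕ} {I : Ideal R} (h : (⊥ : Ideal R).IsTypeOne d) (hI : ringKrullDim (R ⧸ I) < d) :
    ∃ w ∈ I, w ∈ nonZeroDivisors R := by
  have : Subsingleton ((R ⧸ I) →ₗ[R] R) := by
    suffices H : ∀ f : (R ⧸ I) →ₗ[R] R, f = 0 from ⟨fun f g ↦ (H f).trans (H g).symm⟩
    intro f
    by_contra hf
    have h1 : f 1 ≠ 0 := fun h0 ↦ hf (by ext; simpa using h0)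
    refine hI.not_ge (h.le_ringKrullDim (y := f 1) (by simpa using h1) fun r hr ↦ ?_)
    rw [Ideal.mem_bot, ← smul_eq_mul, ← map_smul, Algebra.smul_def, mul_one]
    rw [Ideal.Quotient.algebraMap_eq, Ideal.Quotient.eq_zero_iff_mem.mpr hr, map_zero]
  obtain ⟨w, hw, hreg⟩ := IsSMulRegular.subsingleton_linearMap_iff.mp this
  rw [Ideal.annihilator_quotient] at hw
  refine ⟨w, hw, mem_nonZeroDivisors_iff_right.mpr fun z hz ↦ ?_⟩
  exact hreg.right_eq_zero_of_smul (by rwa [smul_eq_mul, mul_comm])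

lemma Ideal.comap_sup_span_singleton {B : Type*} [CommRing B] {φ : R →+* B}
    (hφ : Function.Surjective φ) (a : Ideal B) (x : R) :
    (a ⊔ Ideal.span {φ x}).comap φ = a.comap φ ⊔ Ideal.span {x} := by
  have := Ideal.comap_map_of_surjective φ hφ (a.comap φ ⊔ Ideal.span {x})
  rw [Ideal.map_sup, Ideal.map_comap_of_surjective φ hφ, Ideal.map_span,
    Set.image_singleton] at this
  rw [this, sup_eq_left]
  exact le_sup_of_le_left (Ideal.comap_mono bot_le)

lemma Ideal.IsTypeOne.comap [IsLocalRing R] {B : Type*} [CommRing B] [IsLocalRing B]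
    {φ : R →+* B} (hφ : Function.Surjective φ) {d : ℕ} {a : Ideal B} (ha : a.IsTypeOne d) :
    (a.comap φ).IsTypeOne d := by
  have : IsLocalHom φ := IsLocalHom.of_surjective φ hφ
  have hm (x : R) : φ x ∈ maximalIdeal B ↔ x ∈ maximalIdeal R := by
    simp [IsLocalRing.mem_maximalIdeal, mem_nonunits_iff]
  have hs (y : R) : (∀ x ∈ maximalIdeal R, x * y ∈ a.comap φ) ↔
      ∀ x ∈ maximalIdeal B, x * φ y ∈ a := by
    rw [hφ.forall]
    simp [hm]
  induction d generalizing a with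
  | zero =>
    obtain ⟨t, ht, h1, h2⟩ := ha
    obtain ⟨t, rfl⟩ := hφ t
    refine ⟨t, ht, (hs t).mpr h1, fun y hy ↦ ?_⟩
    rw [← Ideal.comap_sup_span_singleton hφ]
    exact h2 _ ((hs y).mp hy)
  | succ d ih =>
    refine ⟨fun y hy ↦ ha.1 _ ((hs y).mp hy), fun x hx hxa ↦ ?_⟩
    rw [← Ideal.comap_sup_span_singleton hφ]
    refine ih (ha.2 _ ((hm x).mpr hx) ?_) ?_
    · rw [hφ.forall]
      exact fun y hy ↦ hxa y (by rwa [Ideal.mem_comap, map_mul])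
    · intro y
      rw [hφ.forall]
      simp [hm]

lemma Set.Finite.exists_add_mul_notMem_prime {s : Set (Ideal R)} (hs : s.Finite)
    (hp : ∀ P ∈ s, P.IsPrime) {w : R} (hw : ∀ P ∈ s, w ∉ P) (u : R) :
    ∃ c, ∀ P ∈ s, u + c * w ∉ P := by
  induction hn : s.ncard generalizing s with
  | zero =>
    rw [Set.ncard_eq_zero hs] at hn
    simp [hn]
  | succ n ih =>
    have hne : s.Nonempty := by
      rw [Set.nonempty_iff_ne_empty]
      rintro rfl
      simp at hn
    obtain ⟨P, hP⟩ := hs.exists_minimal hne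
    have hfin : (s \ {P}).Finite := hs.sdiff
    obtain ⟨c, hc⟩ := ih hfin (fun Q hQ ↦ hp Q hQ.1) (fun Q hQ ↦ hw Q hQ.1)
      (by rw [Set.ncard_sdiff_singleton_of_mem hP.1, hn]; rfl)
    by_cases hcP : u + c * w ∈ P
    · have hPp := hp P hP.1
      obtain ⟨e, he, heP⟩ : ∃ e ∈ hfin.toFinset.inf id, e ∉ P := by
        rw [← SetLike.not_le_iff_exists, Ideal.IsPrime.inf_le' hPp]
        rintro ⟨Q, hQ, hQP⟩
        have hQ' : Q ∈ s \ {P} := by simpa using hQ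
        exact hQ'.2 (le_antisymm hQP (hP.2 hQ'.1 hQP))
      refine ⟨c + e, fun Q hQ h ↦ ?_⟩
      rw [add_mul, ← add_assoc] at h
      by_cases hQP : Q = P
      · subst hQP
        have := (Ideal.add_mem_iff_right _ hcP).mp h
        exact (hPp.mem_or_mem this).elim heP (hw Q hQ)
      · refine hc Q ⟨hQ, hQP⟩ ((Ideal.add_mem_iff_left _ (Q.mul_mem_right w ?_)).mp h)
        have : hfin.toFinset.inf id ≤ id Q := Finset.inf_le (by simpa using ⟨hQ, hQP⟩)
        exact this he
    · refine ⟨c, fun Q hQ ↦ ?_⟩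
      by_cases hQP : Q = P
      · rwa [hQP]
      · exact hc Q ⟨hQ, hQP⟩

lemma exists_add_mul_mem_nonZeroDivisors [IsNoetherianRing R] {w : R}
    (hw : w ∈ nonZeroDivisors R) (u : R) : ∃ c, u + c * w ∈ nonZeroDivisors R := by
  have key (z : R) : z ∈ nonZeroDivisors R ↔ ∀ P ∈ associatedPrimes R R, z ∉ P := by
    have := Set.ext_iff.mp (biUnion_associatedPrimes_eq_compl_nonZeroDivisors R) z
    simp only [Set.mem_iUnion, Set.mem_compl_iff, SetLike.mem_coe, exists_prop] at this
    rw [← not_iff_not, ← this]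
    simp
  simp only [key] at hw ⊢
  exact (associatedPrimes.finite R R).exists_add_mul_notMem_prime (fun P hP ↦ hP.isPrime) hw u

end

section
open IsLocalRing
variable {A : Type} [CommRing A]

/-- For `x` regular modulo `a`, the sequence `A ⧸ a → A ⧸ a → A ⧸ (a + (x))` is exact. -/
lemma Ideal.exists_shortExact_smul {a : Ideal A} {x : A} (hxa : ∀ y, x * y ∈ a → y ∈ a) :
    ∃ (g : ModuleCat.of A (A ⧸ a) ⟶ ModuleCat.of A (A ⧸ (a ⊔ Ideal.span {x})))
      (w : (x • 𝟙 (ModuleCat.of A (A ⧸ a))) ≫ g = 0),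
      (ShortComplex.mk (x • 𝟙 (ModuleCat.of A (A ⧸ a))) g w).ShortExact := by
  let g : (A ⧸ a) →ₗ[A] (A ⧸ (a ⊔ Ideal.span {x})) := Submodule.factor le_sup_left
  have hg (y : A) : g (Ideal.Quotient.mk a y) = Ideal.Quotient.mk _ y := rfl
  have hx (y : A) : x • Ideal.Quotient.mk a y = Ideal.Quotient.mk a (x * y) := rfl
  refine ⟨ModuleCat.ofHom g, ?_, ?_⟩
  · refine ModuleCat.hom_ext (LinearMap.ext fun (y : A ⧸ a) ↦ ?_)
    obtain ⟨y, rfl⟩ := Ideal.Quotient.mk_surjective y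
    change g (x • Ideal.Quotient.mk a y) = 0
    rw [hx, hg, Ideal.Quotient.eq_zero_iff_mem]
    exact Ideal.mem_sup_right (Ideal.mul_mem_right _ _ (Ideal.mem_span_singleton_self x))
  · refine { exact := ?_, mono_f := ?_, epi_g := ?_ }
    · rw [ShortComplex.moduleCat_exact_iff]
      intro (y : A ⧸ a) hy
      obtain ⟨y, rfl⟩ := Ideal.Quotient.mk_surjective y
      change g (Ideal.Quotient.mk a y) = 0 at hy
      rw [hg, Ideal.Quotient.eq_zero_iff_mem] at hy
      obtain ⟨p, hp, z, hz, rfl⟩ := Submodule.mem_sup.mp hy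
      obtain ⟨r, rfl⟩ := Ideal.mem_span_singleton'.mp hz
      refine ⟨Ideal.Quotient.mk a r, ?_⟩
      change x • Ideal.Quotient.mk a r = _
      rw [hx, map_add, Ideal.Quotient.eq_zero_iff_mem.mpr hp, zero_add, mul_comm]
    · rw [ModuleCat.mono_iff_injective]
      exact Ideal.isSMulRegular_quotient_iff.mpr hxa
    · rw [ModuleCat.epi_iff_surjective]
      exact Ideal.Quotient.factor_surjective le_sup_left

variable [IsLocalRing A]

lemma Ideal.exists_residueField_linearMap {a : Ideal A} {y : A}
    (hy : ∀ x ∈ maximalIdeal A, x * y ∈ a) :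
    ∃ f : IsLocalRing.ResidueField A →ₗ[A] A ⧸ a, f 1 = Ideal.Quotient.mk a y := by
  obtain ⟨f, hf⟩ := LinearMap.exists_comp_eq_of_ker_le
    (Algebra.linearMap A (IsLocalRing.ResidueField A)) IsLocalRing.residue_surjective
    (LinearMap.toSpanSingleton A (A ⧸ a) (Ideal.Quotient.mk a y)) (by
      intro x hx
      rw [LinearMap.mem_ker, LinearMap.toSpanSingleton_apply]
      refine Ideal.Quotient.eq_zero_iff_mem.mpr (hy x ?_)
      exact (IsLocalRing.residue_eq_zero_iff x).mp hx)
  refine ⟨f, ?_⟩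
  have := hf 1
  rwa [Algebra.linearMap_apply, map_one, LinearMap.toSpanSingleton_apply, one_smul] at this

lemma IsLocalRing.smul_residueField_eq_zero {x : A} (hx : x ∈ maximalIdeal A)
    (c : IsLocalRing.ResidueField A) : x • c = 0 := by
  rw [Algebra.smul_def, IsLocalRing.ResidueField.algebraMap_eq, (residue_eq_zero_iff x).mpr hx, zero_mul]

lemma Ideal.isTypeOne_of_extMod {d : ℕ} {a : Ideal A}
    (h0 : ∀ i < d, Subsingleton (extMod A i (ModuleCat.of A (IsLocalRing.ResidueField A))
      (ModuleCat.of A (A ⧸ a))))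
    (hd : Nonempty (extMod A d (ModuleCat.of A (IsLocalRing.ResidueField A)) (ModuleCat.of A (A ⧸ a))
      ≃ₗ[A] IsLocalRing.ResidueField A)) : a.IsTypeOne d := by
  induction d generalizing a with
  | zero =>
    obtain ⟨e₀⟩ := nonempty_extMod_zero_equiv (ModuleCat.of A (IsLocalRing.ResidueField A))
      (ModuleCat.of A (A ⧸ a))
    obtain ⟨e₁⟩ := hd
    let e : (IsLocalRing.ResidueField A →ₗ[A] A ⧸ a) ≃ₗ[A] IsLocalRing.ResidueField A :=
      e₀.symm.trans e₁
    obtain ⟨t, ht⟩ := Ideal.Quotient.mk_surjective (e.symm 1 1)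
    refine ⟨t, fun hta ↦ ?_, fun x hx ↦ ?_, fun y hy ↦ ?_⟩
    · rw [Ideal.Quotient.eq_zero_iff_mem.mpr hta] at ht
      have h : e.symm 1 = 0 := by
        ext c
        obtain ⟨c, rfl⟩ := IsLocalRing.residue_surjective c
        have : residue A c = c • (1 : IsLocalRing.ResidueField A) := by
          rw [Algebra.smul_def, mul_one, IsLocalRing.ResidueField.algebraMap_eq]
        rw [this, map_smul, ← ht, smul_zero, LinearMap.zero_apply]
      exact one_ne_zero ((LinearEquiv.map_eq_zero_iff _).mp h)
    · rw [← Ideal.Quotient.eq_zero_iff_mem]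
      change x • Ideal.Quotient.mk a t = 0
      rw [ht, ← map_smul, smul_residueField_eq_zero hx, map_zero]
    · obtain ⟨f, hf⟩ := Ideal.exists_residueField_linearMap hy
      obtain ⟨c, hc⟩ := IsLocalRing.residue_surjective (e f)
      have h1 : f = c • e.symm 1 := by
        rw [← map_smul, LinearEquiv.eq_symm_apply, ← hc, Algebra.smul_def, mul_one,
          IsLocalRing.ResidueField.algebraMap_eq]
      have h2 : Ideal.Quotient.mk a y = Ideal.Quotient.mk a (c * t) := by
        rw [← hf, h1, LinearMap.smul_apply, ← ht]
        rfl
      rw [Ideal.Quotient.eq] at h2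
      rw [← sub_add_cancel y (c * t)]
      exact Submodule.add_mem_sup h2 (Ideal.mem_span_singleton'.mpr ⟨c, rfl⟩)
  | succ d ih =>
    constructor
    · intro y hy
      obtain ⟨e₀⟩ := nonempty_extMod_zero_equiv (ModuleCat.of A (IsLocalRing.ResidueField A))
        (ModuleCat.of A (A ⧸ a))
      have := h0 0 d.succ_pos
      have hsub : Subsingleton (IsLocalRing.ResidueField A →ₗ[A] A ⧸ a) :=
        e₀.symm.toEquiv.subsingleton
      obtain ⟨f, hf⟩ := Ideal.exists_residueField_linearMap hy
      rw [← Ideal.Quotient.eq_zero_iff_mem, ← hf, Subsingleton.elim f 0, LinearMap.zero_apply]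
    · intro x hx hxa
      obtain ⟨g, w, hS⟩ := Ideal.exists_shortExact_smul hxa
      refine ih (fun i hi ↦ ?_) ?_
      · have := h0 (i + 1) (by lia)
        obtain ⟨e⟩ := extMod_of_shortExact_smul
          (k := ModuleCat.of A (IsLocalRing.ResidueField A)) g w hS i
          (h0 i (by lia)) fun y ↦ Subsingleton.elim _ _
        exact e.toEquiv.subsingleton
      · obtain ⟨e'⟩ := hd
        obtain ⟨e⟩ := extMod_of_shortExact_smul
          (k := ModuleCat.of A (IsLocalRing.ResidueField A)) g w hS d
          (h0 d (by lia)) fun y ↦ by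
            apply e'.injective
            rw [map_smul, smul_residueField_eq_zero hx, map_zero]
        exact ⟨e.trans e'⟩

lemma IsGorensteinLocalOfDim.isTypeOne_bot {d : ℕ} (h : IsGorensteinLocalOfDim A d) :
    (⊥ : Ideal A).IsTypeOne d := by
  obtain ⟨-, -, hdepth, ⟨e⟩⟩ := h
  let iso (i : ℕ) : extMod A i (ModuleCat.of A (IsLocalRing.ResidueField A))
      (ModuleCat.of A (A ⧸ (⊥ : Ideal A))) ≃ₗ[A]
        extMod A i (ModuleCat.of A (IsLocalRing.ResidueField A)) (ModuleCat.of A A) :=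
    (((_root_.Ext A (ModuleCat.{0} A) i).obj (Opposite.op _)).mapIso
      (Submodule.quotEquivOfEqBot (⊥ : Ideal A) rfl).toModuleIso).toLinearEquiv
  refine Ideal.isTypeOne_of_extMod (fun i hi ↦ ?_) ⟨(iso d).trans e⟩
  have := not_not.mp (Nat.notMem_of_lt_sInf (hi.trans_eq hdepth.symm))
  exact (iso i).toEquiv.subsingleton

end

section
variable {R : Type*} [CommRing R]

lemma Ideal.IsColonGenerator.add_mul {a b : Ideal R} {u w : R} (h : a.IsColonGenerator b u)
    (hw : w ∈ a) (c : R) : a.IsColonGenerator b (u + c * w) := by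
  have hcw : c * w ∈ a := a.mul_mem_left c hw
  refine ⟨fun v hv ↦ ?_, fun r ↦ ?_⟩
  · obtain ⟨p, hp, z, hz, rfl⟩ := Submodule.mem_sup.mp (h.1 v hv)
    obtain ⟨r, rfl⟩ := Ideal.mem_span_singleton'.mp hz
    refine Submodule.mem_sup.mpr ⟨p - r * (c * w), a.sub_mem hp (a.mul_mem_left r hcw),
      r * (u + c * w), Ideal.mem_span_singleton'.mpr ⟨r, rfl⟩, by ring⟩
  · rw [mul_add, Ideal.add_mem_iff_left _ (a.mul_mem_left r hcw), h.2]

/-- The homomorphism `y ↦ u * y / w` determined by `u ∈ ((w) : I)`. -/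
lemma Ideal.exists_linearMap_mul_eq {I : Ideal R} {w u : R} (hw : w ∈ nonZeroDivisors R)
    (hu : ∀ y ∈ I, y * u ∈ Ideal.span {w}) : ∃ s : I →ₗ[R] R, ∀ y, w * s y = u * y := by
  have h (y : I) : ∃ v, w * v = u * y := by
    obtain ⟨v, hv⟩ := Ideal.mem_span_singleton'.mp (hu y y.2)
    exact ⟨v, by linear_combination hv⟩
  choose s hs using h
  refine ⟨{ toFun := s, map_add' := fun y z ↦ ?_, map_smul' := fun r y ↦ ?_ }, hs⟩
  · rw [← mul_cancel_left_mem_nonZeroDivisors hw, mul_add, hs, hs, hs, Submodule.coe_add, mul_add]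
  · rw [← mul_cancel_left_mem_nonZeroDivisors hw, hs, RingHom.id_apply, smul_eq_mul,
      mul_left_comm, hs, Submodule.coe_smul, smul_eq_mul, mul_left_comm]

lemma Ideal.mul_apply_comm {I : Ideal R} (f : I →ₗ[R] R) (y z : I) :
    (y : R) * f z = z * f y := by
  rw [← smul_eq_mul, ← smul_eq_mul, ← map_smul, ← map_smul]
  exact congrArg f (Subtype.ext (mul_comm _ _))

lemma Ideal.IsColonGenerator.exists_hom {I : Ideal R} {w u : R}
    (hw : w ∈ nonZeroDivisors R) (hwI : w ∈ I) (hu : u ∈ nonZeroDivisors R)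
    (h : (Ideal.span {w}).IsColonGenerator I u) :
    ∃ s : I →ₗ[R] R,
      Function.Injective s ∧
      ((∀ r : R,
        r • (Submodule.Quotient.mk s :
            (I →ₗ[R] R) ⧸ Submodule.span R {Submodule.subtype I}) = 0 ↔ r ∈ I) ∧
       Submodule.span R
        {(Submodule.Quotient.mk s :
            (I →ₗ[R] R) ⧸ Submodule.span R {Submodule.subtype I})} = ⊤) ∧
      Submodule.span R {Submodule.subtype I, s} = ⊤ := by
  obtain ⟨s, hs⟩ := Ideal.exists_linearMap_mul_eq hw fun y hy ↦ (h.2 y).mpr hy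
  have hgen (f : I →ₗ[R] R) : ∃ α β : R, f = α • Submodule.subtype I + β • s := by
    have h1 := h.1 (f ⟨w, hwI⟩) fun y hy ↦ Ideal.mem_span_singleton'.mpr
      ⟨f ⟨y, hy⟩, by linear_combination Ideal.mul_apply_comm f ⟨w, hwI⟩ ⟨y, hy⟩⟩
    obtain ⟨p, hp, z, hz, hpz⟩ := Submodule.mem_sup.mp h1
    obtain ⟨α, rfl⟩ := Ideal.mem_span_singleton'.mp hp
    obtain ⟨β, rfl⟩ := Ideal.mem_span_singleton'.mp hz
    refine ⟨α, β, LinearMap.ext fun y ↦ ?_⟩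
    rw [← mul_cancel_left_mem_nonZeroDivisors hw]
    have h2 := Ideal.mul_apply_comm f ⟨w, hwI⟩ y
    simp only [LinearMap.add_apply, LinearMap.smul_apply, Submodule.subtype_apply, smul_eq_mul]
    linear_combination h2 - (y : R) * hpz - β * hs y
  refine ⟨s, ?_, ⟨fun r ↦ ?_, ?_⟩, ?_⟩
  · rw [injective_iff_map_eq_zero]
    intro y hy
    have := hs y
    rw [hy, mul_zero] at this
    exact Subtype.ext ((mul_left_mem_nonZeroDivisors_eq_zero_iff hu).mp this.symm)
  · rw [← Submodule.Quotient.mk_smul, Submodule.Quotient.mk_eq_zero,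
      Submodule.mem_span_singleton, ← h.2, Ideal.mem_span_singleton']
    refine exists_congr fun α ↦ ⟨fun hα ↦ ?_, fun hα ↦ LinearMap.ext fun y ↦ ?_⟩
    · have h1 := LinearMap.congr_fun hα ⟨w, hwI⟩
      simp only [LinearMap.smul_apply, Submodule.subtype_apply, smul_eq_mul] at h1
      have h2 : w * s ⟨w, hwI⟩ = u * w := hs ⟨w, hwI⟩
      rw [← mul_cancel_left_mem_nonZeroDivisors hw]
      linear_combination w * h1 + r * h2
    · rw [← mul_cancel_left_mem_nonZeroDivisors hw]
      simp only [LinearMap.smul_apply, Submodule.subtype_apply, smul_eq_mul]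
      linear_combination (y : R) * hα - r * hs y
  · refine eq_top_iff.mpr fun q _ ↦ ?_
    obtain ⟨f, rfl⟩ := Submodule.Quotient.mk_surjective _ q
    obtain ⟨α, β, rfl⟩ := hgen f
    refine Submodule.mem_span_singleton.mpr ⟨β, ?_⟩
    rw [← Submodule.Quotient.mk_smul, eq_comm, Submodule.Quotient.eq, add_sub_cancel_right]
    exact Submodule.smul_mem _ _ (Submodule.mem_span_singleton_self _)
  · refine eq_top_iff.mpr fun f _ ↦ ?_
    obtain ⟨α, β, rfl⟩ := hgen f
    exact Submodule.mem_span_pair.mpr ⟨α, β, rfl⟩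

end

/-- Let `(R, 𝔪)` be a Noetherian Gorenstein local ring of dimension `n` and
`I ⊆ R` a proper ideal with `R/I` Gorenstein local of dimension `n - 1`; write `ι : I → R`
for the inclusion.  Then there is an `R`-module homomorphism `s : I → R` such that
(i) `s` is injective;
(ii) `Ext¹_R(R/I, R) ≅ Hom_R(I, R)/(R·ι)` is a free `R/I`-module of rank one with basis the
class of `s` (i.e. the annihilator of the class of `s` is exactly `I` and the class of `s`
spans the quotient);
(iii) `Hom_R(I, R)` is generated as an `R`-module by `ι` and `s`. -/
theorem exists_unprojection_hom (R : Type) [CommRing R] [IsLocalRing R] (n : ℕ) (hn : 0 < n)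
    (I : Ideal R) (hI : I ≠ ⊤) [IsLocalRing (R ⧸ I)]
    (hGR : IsGorensteinLocalOfDim R n)
    (hGRI : IsGorensteinLocalOfDim (R ⧸ I) (n - 1)) :
    ∃ s : I →ₗ[R] R,
      Function.Injective s ∧
      ((∀ r : R,
        r • (Submodule.Quotient.mk s :
            (I →ₗ[R] R) ⧸ Submodule.span R {Submodule.subtype I}) = 0 ↔ r ∈ I) ∧
       Submodule.span R
        {(Submodule.Quotient.mk s :
            (I →ₗ[R] R) ⧸ Submodule.span R {Submodule.subtype I})} = ⊤) ∧
      Submodule.span R {Submodule.subtype I, s} = ⊤ := by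
  obtain ⟨n, rfl⟩ : ∃ m, n = m + 1 := ⟨n - 1, by lia⟩
  have hR := hGR.isTypeOne_bot
  have hRI := hGRI.isTypeOne_bot.comap (Ideal.Quotient.mk_surjective (I := I))
  obtain ⟨hN, hdimR, -⟩ := hGR
  obtain ⟨-, hdimI, -⟩ := hGRI
  rw [Nat.add_sub_cancel] at hRI hdimI
  rw [← RingHom.ker_eq_comap_bot, Ideal.mk_ker] at hRI
  obtain ⟨w, hwI, hw⟩ := hR.exists_regular_mem (I := I) (by
    rw [hdimI]
    exact_mod_cast n.lt_succ_self)
  have hwm : w ∈ IsLocalRing.maximalIdeal R := IsLocalRing.le_maximalIdeal hI hwI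
  have hw0 (y : R) (hy : w * y ∈ (⊥ : Ideal R)) : y ∈ (⊥ : Ideal R) :=
    (mul_left_mem_nonZeroDivisors_eq_zero_iff hw).mp hy
  have hW := hR.2 w hwm hw0
  have hdimW := Ideal.ringKrullDim_quotient_sup_span_singleton_eq hwm hw0
    ((ringKrullDim_eq_of_ringEquiv (RingEquiv.quotientBot R)).trans hdimR)
  rw [bot_sup_eq] at hW hdimW
  obtain ⟨-, u, hu⟩ := hW.homsAreMul_and_exists_isColonGenerator
    ((Ideal.span_singleton_le_iff_mem I).mpr hwI) hRI hdimW hdimI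
  obtain ⟨c, hc⟩ := exists_add_mul_mem_nonZeroDivisors hw u
  exact (hu.add_mul (Ideal.mem_span_singleton_self w) c).exists_hom hw hwI hc
end

section
/- Let s : I → R be an injective R-module homomorphism whose class generates Ext¹_R(R/I, R) as an R/I-module, and set J = s(I). Then every associated prime of the R-module R/J has height exactly 1; in particular, if J ≠ R then dim R/J = n − 1 and R/J has no embedded primes. -/
open CategoryTheory

theorem subsingleton_abelianExt_of_extMod (R : Type) [CommRing R] (i : ℕ) (M N : ModuleCat.{0} R)
    (h : Subsingleton (extMod R i M N)) : Subsingleton (Abelian.Ext.{0} M N i) := by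
  let P := projectiveResolution M
  have hz : Limits.IsZero ((P.complex.linearYonedaObj R N).homology i) :=
    (ModuleCat.isZero_of_subsingleton (extMod R i M N)).of_iso (P.isoExt i N).symm
  rw [← HomologicalComplex.exactAt_iff_isZero_homology] at hz
  refine ⟨fun a b => ?_⟩
  suffices H : ∀ α : Abelian.Ext.{0} M N i, α = 0 by rw [H a, H b]
  intro α
  obtain ⟨f, hf, rfl⟩ := P.extMk_surjective α (i + 1) rfl
  cases i with
  | zero =>
    have hz' := (HomologicalComplex.exactAt_iff' _ 0 0 1 (by simp) (by simp)).1 hz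
    rw [ShortComplex.moduleCat_exact_iff] at hz'
    obtain ⟨g, hg⟩ := hz' f hf
    have : f = 0 := by
      rw [← hg]
      change P.complex.d 0 0 ≫ g = 0
      rw [P.complex.shape 0 0 (by simp)]
      exact Limits.zero_comp
    subst this
    exact P.extMk_zero _ _
  | succ p =>
    have hz' := (HomologicalComplex.exactAt_iff' _ p (p + 1) (p + 2) (by simp) (by simp)).1 hz
    rw [ShortComplex.moduleCat_exact_iff] at hz'
    obtain ⟨g, hg⟩ := hz' f hf
    exact (P.extMk_eq_zero_iff f _ rfl hf p rfl).2 ⟨g, hg⟩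

section

variable {R : Type} [CommRing R] [IsLocalRing R]

/-- The groups `Ext^i(k, M)` vanish for `i < m`, where `k` is the residue field. -/
def ExtVanishesBelow (m : ℕ) (M : ModuleCat.{0} R) : Prop :=
  ∀ i < m, Subsingleton
    (Abelian.Ext.{0} (ModuleCat.of R (IsLocalRing.ResidueField R)) M i)

theorem ExtVanishesBelow.of_ringDepth {m : ℕ} (h : ringDepth R = m) :
    ExtVanishesBelow m (ModuleCat.of R R) := by
  intro i hi
  apply subsingleton_abelianExt_of_extMod
  by_contra hc
  exact absurd (h.ge.trans (Nat.sInf_le hc)) (by lia)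

theorem ExtVanishesBelow.quotSMulTop {m : ℕ} {M : ModuleCat.{0} R}
    (h : ExtVanishesBelow (m + 1) M) {x : R} (hx : IsSMulRegular M x) :
    ExtVanishesBelow m (ModuleCat.of R (QuotSMulTop x M)) := by
  intro i hi
  have zero1 := AddCommGrpCat.isZero_of_iff_subsingleton.mpr (h i (by lia))
  have zero2 := AddCommGrpCat.isZero_of_iff_subsingleton.mpr (h (i + 1) (by lia))
  exact AddCommGrpCat.subsingleton_of_isZero <| ShortComplex.Exact.isZero_of_both_zeros
    ((Abelian.Ext.covariant_sequence_exact₃' _ hx.smulShortComplex_shortExact) i (i + 1) rfl)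
    (zero1.eq_zero_of_src _) (zero2.eq_zero_of_tgt _)

open scoped Pointwise in
theorem exists_associatedPrime_quotSMulTop [IsNoetherianRing R] {M : Type} [AddCommGroup M]
    [Module R M] [Module.Finite R M] {x : R} (hxm : x ∈ IsLocalRing.maximalIdeal R)
    (hx : IsSMulRegular M x) {Q : Ideal R} (hQ : Q ∈ associatedPrimes R M) :
    ∃ Q' ∈ associatedPrimes R (QuotSMulTop x M), Q ≤ Q' ∧ x ∈ Q' := by
  obtain ⟨hQp, z, hz⟩ := (isAssociatedPrime_iff).1 hQ
  have hz0 : z ≠ 0 := by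
    rintro rfl
    apply hQp.ne_top
    rw [hz, Ideal.eq_top_iff_one, Submodule.mem_colon_singleton]
    simp
  let N : Submodule R M := Submodule.torsionBySet R M Q
  have hN : ∀ w, w ∈ N ↔ ∀ q ∈ Q, q • w = 0 := fun w => by
    simp [N, Submodule.mem_torsionBySet_iff]
  have hzN : z ∈ N := (hN z).2 fun q hq => by
    rw [hz] at hq
    simpa [Submodule.mem_colon_singleton] using hq
  have hex : ∃ w ∈ N, w ∉ x • (⊤ : Submodule R M) := by
    by_contra! hc
    have hle : N ≤ IsLocalRing.maximalIdeal R • N := by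
      intro w hw
      obtain ⟨v, -, rfl⟩ := (Submodule.mem_smul_pointwise_iff_exists _ _ _).1 (hc w hw)
      refine Submodule.smul_mem_smul hxm ((hN v).2 fun q hq => hx ?_)
      have := (hN _).1 hw q hq
      simp only [smul_zero]
      rw [← this, smul_comm]
    have hbot : N = ⊥ := Submodule.eq_bot_of_le_smul_of_le_jacobson_bot _ N
      (IsNoetherian.noetherian N) hle (IsLocalRing.maximalIdeal_le_jacobson _)
    rw [hbot] at hzN
    exact hz0 (by simpa using hzN)
  obtain ⟨w, hw, hwx⟩ := hex
  obtain ⟨Q', hQ', hle⟩ := exists_le_isAssociatedPrime_of_isNoetherianRing R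
    (Submodule.Quotient.mk w : QuotSMulTop x M)
    (by rwa [Ne, Submodule.Quotient.mk_eq_zero])
  refine ⟨Q', hQ', fun q hq => hle ?_, hle ?_⟩
  · rw [Submodule.mem_colon_singleton, ← Submodule.Quotient.mk_smul, (hN w).1 hw q hq]
    simp
  · rw [Submodule.mem_colon_singleton, Submodule.mem_bot, ← Submodule.Quotient.mk_smul,
      Submodule.Quotient.mk_eq_zero]
    exact Submodule.smul_mem_pointwise_smul _ _ _ trivial

theorem ringKrullDim_quotient_add_one_le_of_lt {S : Type} [CommRing S] {P Q : Ideal S}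
    [P.IsPrime] (h : P < Q) : ringKrullDim (S ⧸ Q) + 1 ≤ ringKrullDim (S ⧸ P) := by
  obtain ⟨x, hxQ, hxP⟩ := SetLike.exists_of_lt h
  refine ringKrullDim_succ_le_of_surjective (Ideal.Quotient.factor h.le)
    (Ideal.Quotient.factor_surjective h.le) (r := Ideal.Quotient.mk P x) ?_ ?_
  · rw [mem_nonZeroDivisors_iff_ne_zero]
    rwa [Ne, Ideal.Quotient.eq_zero_iff_mem]
  · simpa [Ideal.Quotient.eq_zero_iff_mem] using hxQ

/-- If `Ext^i(k, M) = 0` for `i < m`, every associated prime of `M` has dimension at least `m`. -/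
theorem ExtVanishesBelow.le_ringKrullDim_quotient [IsNoetherianRing R] {m : ℕ}
    {M : ModuleCat.{0} R} [Module.Finite R M] (h : ExtVanishesBelow m M) {Q : Ideal R}
    (hQ : Q ∈ associatedPrimes R M) : (m : WithBot ℕ∞) ≤ ringKrullDim (R ⧸ Q) := by
  induction m generalizing M Q with
  | zero =>
    have := Ideal.Quotient.nontrivial_iff.2 hQ.isPrime.ne_top
    simpa using ringKrullDim_nonneg_of_nontrivial (R := R ⧸ Q)
  | succ m ih =>
    have h0 := Abelian.Ext.addEquiv₀.subsingleton_congr.mp (h 0 m.succ_pos)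
    have h1 : Subsingleton (IsLocalRing.ResidueField R →ₗ[R] M) :=
      (ModuleCat.homAddEquiv (M := ModuleCat.of R (IsLocalRing.ResidueField R))
        (N := M)).symm.subsingleton
    obtain ⟨x, hxa, hx⟩ := IsSMulRegular.subsingleton_linearMap_iff.mp h1
    have hxm : x ∈ IsLocalRing.maximalIdeal R := by
      have := Module.mem_annihilator.1 hxa 1
      rwa [Algebra.smul_def, mul_one, IsLocalRing.ResidueField.algebraMap_eq,
        IsLocalRing.residue_eq_zero_iff] at this
    obtain ⟨Q', hQ', hle, hxQ'⟩ := exists_associatedPrime_quotSMulTop hxm hx hQ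
    have hxQ : x ∉ Q := fun hxQ => by
      have : x ∈ ⋃ p ∈ associatedPrimes R M, (p : Set R) := Set.mem_biUnion hQ hxQ
      rw [biUnion_associatedPrimes_eq_compl_regular] at this
      exact this hx
    have := hQ.isPrime
    have hlt : Q < Q' := lt_of_le_of_ne hle fun e => hxQ (e ▸ hxQ')
    have := ih (M := ModuleCat.of R (QuotSMulTop x M)) (h.quotSMulTop hx) hQ'
    push_cast
    exact (add_le_add_left this 1).trans (ringKrullDim_quotient_add_one_le_of_lt hlt)

end

theorem Ideal.height_add_ringKrullDim_quotient_le {S : Type*} [CommRing S] (P : Ideal S)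
    [hP : P.IsPrime] : (P.height : WithBot ℕ∞) + ringKrullDim (S ⧸ P) ≤ ringKrullDim S := by
  let p : PrimeSpectrum S := ⟨P, hP⟩
  have : Nonempty (PrimeSpectrum S) := ⟨p⟩
  have e : ringKrullDim (S ⧸ P) = (Order.coheight p : ℕ∞) := by
    rw [ringKrullDim_quotient, Order.coheight_eq_krullDim_Ici]
    rfl
  rw [e, ringKrullDim, Order.krullDim_eq_iSup_height_add_coheight_of_nonempty,
    show P.height = Order.height p from PrimeSpectrum.height_eq_orderHeight p, ← WithBot.coe_add,
    WithBot.coe_le_coe]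
  exact le_iSup (fun a : PrimeSpectrum S => Order.height a + Order.coheight a) p

theorem Ideal.exists_isSMulRegular_and_of_forall_not_le {R S : Type*} [CommRing R] [CommRing S]
    [IsNoetherianRing R] [IsNoetherianRing S] (f : R →+* S) {M N : Type*}
    [AddCommGroup M] [Module R M] [Module.Finite R M]
    [AddCommGroup N] [Module S N] [Module.Finite S N] (P : Ideal R)
    (hM : ∀ Q ∈ associatedPrimes R M, ¬ P ≤ Q)
    (hN : ∀ Q ∈ associatedPrimes S N, ¬ P ≤ Q.comap f) :
    ∃ y ∈ P, IsSMulRegular M y ∧ IsSMulRegular N (f y) := by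
  by_contra! hc
  have hfin := (associatedPrimes.finite R M).union ((associatedPrimes.finite S N).image (comap f))
  have hsub : (P : Set R) ⊆
      ⋃ Q ∈ associatedPrimes R M ∪ comap f '' associatedPrimes S N, (Q : Set R) := by
    intro y hy
    rw [Set.biUnion_union]
    by_cases h : IsSMulRegular M y
    · right
      have h' : f y ∈ ⋃ Q ∈ associatedPrimes S N, (Q : Set S) := by
        rw [biUnion_associatedPrimes_eq_compl_regular]
        exact hc y hy h
      simpa using h'
    · left
      rw [biUnion_associatedPrimes_eq_compl_regular]
      exact h
  have hprime : ∀ Q ∈ associatedPrimes R M ∪ comap f '' associatedPrimes S N,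
      Q ≠ 0 → Q ≠ 0 → Q.IsPrime := by
    rintro Q (hQ | ⟨Q, hQ, rfl⟩) - -
    · exact hQ.isPrime
    · have := hQ.isPrime
      infer_instance
  obtain ⟨Q, hQ | ⟨Q, hQ, rfl⟩, hle⟩ :=
    (P.subset_union_prime_finite hfin (f := id) 0 0 hprime).1 hsub
  · exact hM Q hQ hle
  · exact hN Q hQ hle

theorem Ideal.exists_isSMulRegular_of_forall_not_le {R : Type*} [CommRing R] [IsNoetherianRing R]
    {M : Type*} [AddCommGroup M] [Module R M] [Module.Finite R M] (P : Ideal R)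
    (hM : ∀ Q ∈ associatedPrimes R M, ¬ P ≤ Q) : ∃ y ∈ P, IsSMulRegular M y := by
  obtain ⟨y, hy, h, -⟩ :=
    P.exists_isSMulRegular_and_of_forall_not_le (RingHom.id R) (M := M) (N := M) hM hM
  exact ⟨y, hy, h⟩

theorem IsSMulRegular.apply_of_injective {R : Type*} [CommRing R] {I : Ideal R} {s : I →ₗ[R] R}
    (hs : Function.Injective s) {a : R} (ha : IsSMulRegular R a) (haI : a ∈ I) :
    IsSMulRegular R (s ⟨a, haI⟩) := by
  intro r t h
  have h' : r • (⟨a, haI⟩ : I) = t • ⟨a, haI⟩ := hs (by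
    rw [map_smul, map_smul]
    simpa [mul_comm] using h)
  exact ha (by simpa [mul_comm] using congrArg Subtype.val h')

theorem not_mem_associatedPrimes_quotient_range {R : Type*} [CommRing R] [IsNoetherianRing R]
    {I : Ideal R} {s : I →ₗ[R] R} (hs : Function.Injective s) {x y : R}
    (hx : IsSMulRegular R x) (hyx : IsSMulRegular (QuotSMulTop x R) y)
    (hyI : IsSMulRegular (R ⧸ I) (Ideal.Quotient.mk I y)) {P : Ideal R} (hxP : x ∈ P)
    (hyP : y ∈ P) : P ∉ associatedPrimes R (R ⧸ (LinearMap.range s : Ideal R)) := by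
  intro hP
  obtain ⟨hprime, z, hz⟩ := isAssociatedPrime_iff.1 hP
  obtain ⟨b, rfl⟩ := Submodule.Quotient.mk_surjective _ z
  have hmem (r : R) (hr : r ∈ P) : ∃ i, s i = r * b := by
    rw [hz, Submodule.mem_colon_singleton, Submodule.mem_bot, ← Submodule.Quotient.mk_smul,
      Submodule.Quotient.mk_eq_zero] at hr
    exact hr
  obtain ⟨i, hi⟩ := hmem x hxP
  obtain ⟨j, hj⟩ := hmem y hyP
  have hij : y * (i : R) = x * j := by
    have : y • i = x • j := hs (by simp [hi, hj, mul_left_comm])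
    simpa using congrArg Subtype.val this
  obtain ⟨c, hc⟩ : ∃ c, x * c = (i : R) := by
    have h0 : (Submodule.Quotient.mk (i : R) : QuotSMulTop x R) = 0 := hyx (by
      simp only [smul_zero]
      rw [← Submodule.Quotient.mk_smul, Submodule.Quotient.mk_eq_zero, smul_eq_mul, hij]
      exact Submodule.smul_mem_pointwise_smul _ _ _ trivial)
    rw [Submodule.Quotient.mk_eq_zero] at h0
    obtain ⟨c, -, hc⟩ := (Submodule.mem_smul_pointwise_iff_exists _ _ _).1 h0
    exact ⟨c, hc⟩
  have hyc : y * c = j := hx (by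
    change x * (y * c) = x * j
    rw [← hij, ← hc, mul_left_comm])
  have hcI : c ∈ I := by
    rw [← Ideal.Quotient.eq_zero_iff_mem]
    refine hyI ?_
    change Ideal.Quotient.mk I y * Ideal.Quotient.mk I c = Ideal.Quotient.mk I y * 0
    rw [← map_mul, mul_zero, hyc, Ideal.Quotient.eq_zero_iff_mem]
    exact j.2
  have hb : s ⟨c, hcI⟩ = b := hx (by
    change x * s ⟨c, hcI⟩ = x * b
    rw [← hi, ← smul_eq_mul, ← map_smul]
    congr 1
    exact Subtype.ext hc)
  apply hprime.ne_top
  rw [hz, Ideal.eq_top_iff_one, Submodule.mem_colon_singleton, Submodule.mem_bot, one_smul,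
    Submodule.Quotient.mk_eq_zero]
  exact ⟨_, hb⟩

/-- In the unprojection setup (`R` Gorenstein local of dimension `n`,
`I` proper with `R/I` Gorenstein local of dimension `n - 1`), let `s : I → R` be injective
with class generating `Ext¹_R(R/I, R) ≅ Hom_R(I,R)/(R·ι)` as an `R/I`-module, and set
`J = s(I)`.  Then every associated prime of `R/J` has height exactly `1`; in particular, if
`J ≠ R` then `dim R/J = n - 1` and `R/J` has no embedded primes (every associated prime of
`R/J` is a minimal prime of `J`). -/
theorem associatedPrimes_of_unprojection_numerator_ideal (R : Type) [CommRing R]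
    [IsLocalRing R] (n : ℕ) (hn : 0 < n)
    (I : Ideal R) (hI : I ≠ ⊤) [IsLocalRing (R ⧸ I)]
    (hGR : IsGorensteinLocalOfDim R n)
    (hGRI : IsGorensteinLocalOfDim (R ⧸ I) (n - 1))
    (s : I →ₗ[R] R) (hs : Function.Injective s)
    (hgen : Submodule.span R
      {(Submodule.Quotient.mk s :
          (I →ₗ[R] R) ⧸ Submodule.span R {Submodule.subtype I})} = ⊤) :
    (∀ (P : Ideal R) (hP : P.IsPrime),
      P ∈ associatedPrimes R (R ⧸ (LinearMap.range s : Ideal R)) →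
      ringKrullDim (Localization.AtPrime P) = 1) ∧
    ((LinearMap.range s : Ideal R) ≠ ⊤ →
      ringKrullDim (R ⧸ (LinearMap.range s : Ideal R)) = (n - 1 : ℕ) ∧
      ∀ P ∈ associatedPrimes R (R ⧸ (LinearMap.range s : Ideal R)),
        P ∈ Ideal.minimalPrimes (LinearMap.range s : Ideal R)) := by
  obtain ⟨hN, hdim, hdepth, -⟩ := hGR
  obtain ⟨-, hdimI, hdepthI, -⟩ := hGRI
  have hER := ExtVanishesBelow.of_ringDepth hdepth
  have hEI := ExtVanishesBelow.of_ringDepth hdepthI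
  have hlt : ((n - 1 : ℕ) : WithBot ℕ∞) < n := by
    exact_mod_cast Nat.sub_one_lt hn.ne'
  obtain ⟨a, haI, ha⟩ : ∃ a ∈ I, IsSMulRegular R a := by
    refine I.exists_isSMulRegular_of_forall_not_le fun Q hQ hIQ => ?_
    have h1 := hER.le_ringKrullDim_quotient hQ
    have h2 := ringKrullDim_le_of_surjective (Ideal.Quotient.factor hIQ)
      (Ideal.Quotient.factor_surjective hIQ)
    exact (h1.trans (h2.trans hdimI.le)).not_gt hlt
  set J : Ideal R := LinearMap.range s
  let x := s ⟨a, haI⟩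
  have hxJ : x ∈ J := ⟨_, rfl⟩
  have hx : IsSMulRegular R x := ha.apply_of_injective hs haI
  have hx' : x ∈ nonZeroDivisors R :=
    (mem_nonZeroDivisors_iff_right).2 fun r hr => hx (by simpa [mul_comm] using hr)
  have hone (P : Ideal R) (hJP : J ≤ P) : 1 ≤ P.height :=
    (Ideal.one_le_height_span_singleton_of_mem_nonZeroDivisors hx').trans
      (Ideal.height_mono ((Ideal.span_singleton_le_iff_mem P).2 (hJP hxJ)))
  have hEx : ExtVanishesBelow (n - 1) (ModuleCat.of R (QuotSMulTop x R)) :=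
    ExtVanishesBelow.quotSMulTop (M := ModuleCat.of R R) (by rwa [Nat.sub_add_cancel hn]) hx
  have hJP {P : Ideal R} (hP : P ∈ associatedPrimes R (R ⧸ J)) : J ≤ P := by
    have := hP.annihilator_le
    rwa [Submodule.annihilator_top, Ideal.annihilator_quotient] at this
  have hht {P : Ideal R} (hP : P ∈ associatedPrimes R (R ⧸ J)) : P.height = 1 := by
    have := hP.isPrime
    refine le_antisymm ?_ (hone P (hJP hP))
    by_contra! hgt
    have hsmall (Q : Ideal R) (hQ : Q.IsPrime)
        (hd : ((n - 1 : ℕ) : WithBot ℕ∞) ≤ ringKrullDim (R ⧸ Q)) : ¬ P ≤ Q := fun hPQ => by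
      have h1 := Q.height_add_ringKrullDim_quotient_le
      have h2 : (2 : ℕ∞) ≤ Q.height :=
        (Order.add_one_le_of_lt hgt).trans (Ideal.height_mono hPQ)
      have h3 : ((2 : ℕ) : WithBot ℕ∞) + ((n - 1 : ℕ) : WithBot ℕ∞) ≤ n :=
        (add_le_add (WithBot.coe_le_coe.2 h2) hd).trans (h1.trans hdim.le)
      have h4 : 2 + (n - 1) ≤ n := by exact_mod_cast h3
      lia
    obtain ⟨y, hyP, hyx, hyI⟩ : ∃ y ∈ P, IsSMulRegular (QuotSMulTop x R) y ∧
        IsSMulRegular (R ⧸ I) (Ideal.Quotient.mk I y) := by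
      refine P.exists_isSMulRegular_and_of_forall_not_le (Ideal.Quotient.mk I) (fun Q hQ => ?_)
        (fun Q hQ => ?_)
      · exact hsmall Q hQ.isPrime (hEx.le_ringKrullDim_quotient hQ)
      · have := hQ.isPrime
        refine hsmall _ inferInstance ((hEI.le_ringKrullDim_quotient hQ).trans ?_)
        exact ringKrullDim_le_of_surjective (Ideal.quotientMap Q (Ideal.Quotient.mk I) le_rfl)
          (Ideal.quotientMap_surjective Ideal.Quotient.mk_surjective)
    exact not_mem_associatedPrimes_quotient_range hs hx hyx hyI (hJP hP hxJ) hyP hP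
  refine ⟨fun P _ hP => ?_, fun hJ => ⟨le_antisymm ?_ ?_, fun P hP => ?_⟩⟩
  · rw [IsLocalization.AtPrime.ringKrullDim_eq_height P, hht hP]
    rfl
  · have h1 := ringKrullDim_succ_le_of_surjective (Ideal.Quotient.mk J)
      Ideal.Quotient.mk_surjective hx' (Ideal.Quotient.eq_zero_iff_mem.2 hxJ)
    rw [hdim] at h1
    have h2 : (n : WithBot ℕ∞) = ((n - 1 : ℕ) : WithBot ℕ∞) + 1 := by
      exact_mod_cast (Nat.sub_add_cancel hn).symm
    rw [h2] at h1
    exact ENat.WithBot.add_le_add_one_right_iff.1 h1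
  · have := Ideal.Quotient.nontrivial_iff.2 hJ
    obtain ⟨P, hP⟩ := associatedPrimes.nonempty R (R ⧸ J)
    have := hP.isPrime
    have hPx : P ∈ (Ideal.span {x}).minimalPrimes :=
      Ideal.mem_minimalPrimes_of_height_le
        ((Ideal.span_singleton_le_iff_mem P).2 (hJP hP hxJ))
        ((hht hP).le.trans (Ideal.one_le_height_span_singleton_of_mem_nonZeroDivisors hx'))
    have hann : Module.annihilator R (QuotSMulTop x R) = Ideal.span {x} := by
      rw [(Submodule.quotEquivOfEq _ (Ideal.span {x})
        (by rw [← Submodule.ideal_span_singleton_smul, smul_eq_mul, Ideal.mul_top])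
        ).annihilator_eq, Ideal.annihilator_quotient]
    rw [← hann] at hPx
    exact (hEx.le_ringKrullDim_quotient
      (Module.associatedPrimes.minimalPrimes_annihilator_subset_associatedPrimes R _ hPx)).trans
      (ringKrullDim_le_of_surjective (Ideal.Quotient.factor (hJP hP))
        (Ideal.Quotient.factor_surjective (hJP hP)))
  · have := hP.isPrime
    exact Ideal.mem_minimalPrimes_of_height_le (hJP hP)
      ((hht hP).le.trans (hone J le_rfl))
end

section
/- Let s : I → R be an injective R-module homomorphism whose class generates Ext¹_R(R/I, R) as an R/I-module, set J = s(I), and assume I is not principal (equivalently, J ≠ R). Then R/J is a Cohen–Macaulay local ring of Krull dimension n − 1. -/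
open CategoryTheory

/-- A Noetherian local ring `A` is Cohen--Macaulay of dimension `m` if
`depth A = dim A = m`. -/
def IsCohenMacaulayLocalOfDim (A : Type) [CommRing A] [IsLocalRing A] (m : ℕ) : Prop :=
  IsNoetherianRing A ∧ ringKrullDim A = m ∧ ringDepth A = m

open Limits IsLocalRing RingTheory.Sequence

section

variable {R : Type} [CommRing R]

/-- Both constructions of `Ext` vanish simultaneously. -/
lemma subsingleton_extMod_iff (M N : ModuleCat.{0} R) (i : ℕ) :
    Subsingleton (extMod R i M N) ↔ Subsingleton (Abelian.Ext M N i) := by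
  let P := projectiveResolution M
  have h : Subsingleton (extMod R i M N) ↔ (P.complex.linearYonedaObj R N).ExactAt i := by
    rw [HomologicalComplex.exactAt_iff_isZero_homology, ← (P.isoExt i N).isZero_iff,
      ModuleCat.isZero_iff_subsingleton]
    rfl
  rw [h]
  cases i with
  | zero =>
    rw [HomologicalComplex.exactAt_iff' _ 0 0 1 (by simp) (by simp),
      ShortComplex.moduleCat_exact_iff, Abelian.Ext.addEquiv₀.subsingleton_congr]
    constructor
    · intro H
      refine subsingleton_of_forall_eq 0 fun f ↦ ?_
      obtain ⟨g, hg⟩ := H (P.π.f 0 ≫ f) ((P.complex_d_comp_π_f_zero_assoc f).trans zero_comp)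
      refine (cancel_epi (P.π.f 0)).1 ((hg.symm.trans ?_).trans comp_zero.symm)
      have h0 : (P.complex.linearYonedaObj R N).d 0 0 = 0 :=
        HomologicalComplex.shape _ _ _ (by simp)
      exact congrArg (fun φ ↦ φ.hom g) h0
    · intro H f hf
      refine ⟨0, ?_⟩
      rw [map_zero, ← P.exact₀.g_desc f hf,
        Subsingleton.elim (α := M ⟶ N) (P.exact₀.desc f hf) 0]
      exact comp_zero.symm
  | succ i =>
    rw [HomologicalComplex.exactAt_iff' _ i (i + 1) (i + 1 + 1) (by simp) (by simp),
      ShortComplex.moduleCat_exact_iff]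
    constructor
    · intro H
      refine subsingleton_of_forall_eq 0 fun α ↦ ?_
      obtain ⟨f, hf, rfl⟩ := P.extMk_surjective α (i + 1 + 1) rfl
      exact (P.extMk_eq_zero_iff f _ rfl hf i rfl).2 (H f hf)
    · intro H f hf
      exact (P.extMk_eq_zero_iff f _ rfl hf i rfl).1 (Subsingleton.elim _ _)

/-- The local ring `R` has a weakly `M`-regular sequence of length `n` in its maximal ideal. -/
def HasRegularSequence (R : Type) [CommRing R] [IsLocalRing R] (M : Type) [AddCommGroup M]
    [Module R M] (n : ℕ) : Prop :=
  ∃ rs : List R, rs.length = n ∧ (∀ r ∈ rs, r ∈ maximalIdeal R) ∧ IsWeaklyRegular M rs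

lemma forall_subsingleton_ext_residueField_iff {R : Type} [CommRing R] [IsLocalRing R]
    [IsNoetherianRing R] (M : ModuleCat.{0} R) [Module.Finite R M] [Nontrivial M] (n : ℕ) :
    (∀ i < n, Subsingleton (Abelian.Ext (ModuleCat.of R (ResidueField R)) M i)) ↔
      HasRegularSequence R M n := by
  have hlt : maximalIdeal R • (⊤ : Submodule R M) < ⊤ :=
    (Submodule.top_ne_ideal_smul_of_le_jacobson_annihilator
      (maximalIdeal_le_jacobson _)).symm.lt_top
  have hsupp : Module.support R (ModuleCat.of R (ResidueField R)) =
      PrimeSpectrum.zeroLocus (maximalIdeal R) := by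
    change Module.support R (R ⧸ maximalIdeal R) = _
    rw [Module.support_eq_zeroLocus, Ideal.annihilator_quotient]
  have : Module.Finite R (ModuleCat.of R (ResidueField R)) :=
    inferInstanceAs (Module.Finite R (R ⧸ maximalIdeal R))
  constructor
  · intro h
    obtain ⟨rs, hl, hm, hr⟩ := ModuleCat.exists_isRegular_of_exists_subsingleton_ext
      (maximalIdeal R) n M hlt _ hsupp h
    exact ⟨rs, hl, hm, hr.toIsWeaklyRegular⟩
  · rintro ⟨rs, rfl, hm, hr⟩
    exact ModuleCat.subsingleton_ext_of_exists_isRegular (maximalIdeal R) _ hsupp.subset M hlt rs hm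
      (.of_isWeaklyRegular_of_mem_maximalIdeal _ hm hr)

lemma hasRegularSequence_iff_of_surjective {R S : Type} [CommRing R] [IsLocalRing R] [CommRing S]
    [IsLocalRing S] [Algebra R S] (hsurj : Function.Surjective (algebraMap R S)) (M : Type)
    [AddCommGroup M] [Module R M] [Module S M] [IsScalarTower R S M] (n : ℕ) :
    HasRegularSequence R M n ↔ HasRegularSequence S M n := by
  have hloc : IsLocalHom (algebraMap R S) := hsurj.isLocalHom _
  have hmem (r : R) : algebraMap R S r ∈ maximalIdeal S ↔ r ∈ maximalIdeal R := by simp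
  constructor
  · rintro ⟨rs, hl, hm, hr⟩
    exact ⟨rs.map (algebraMap R S), by simpa, by simpa using hm,
      (isWeaklyRegular_map_algebraMap_iff S M rs).2 hr⟩
  · rintro ⟨rs, hl, hm, hr⟩
    obtain ⟨rs, rfl⟩ := List.map_surjective_iff.2 hsurj rs
    exact ⟨rs, by simpa using hl, by simpa using hm,
      (isWeaklyRegular_map_algebraMap_iff S M rs).1 hr⟩

lemma exists_mul_pow_eq_zero_of_mem_minimalPrimes {p : Ideal R} (hp : p ∈ minimalPrimes R)
    {x : R} (hx : x ∈ p) :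
    ∃ t ∉ p, ∃ k : ℕ, t * x ^ k = 0 := by
  have := hp.1.1
  by_contra! H
  have hdisj : Disjoint ((⊥ : Ideal R) : Set R) ↑(p.primeCompl ⊔ Submonoid.powers x) := by
    rw [Set.disjoint_left]
    rintro a rfl h
    obtain ⟨t, ht, _, ⟨k, rfl⟩, h⟩ := Submonoid.mem_sup.1 h
    exact H t ht k h
  obtain ⟨q, hq, -, hqd⟩ := Ideal.exists_le_prime_disjoint _ _ hdisj
  have hqp : q ≤ p := fun a ha ↦ by
    by_contra hap
    exact Set.disjoint_left.1 hqd ha ((le_sup_left : p.primeCompl ≤ _) hap)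
  exact Set.disjoint_left.1 hqd (hp.2 ⟨hq, bot_le⟩ hqp hx)
    ((le_sup_right : Submonoid.powers x ≤ _) (Submonoid.mem_powers x))

lemma le_minimalPrime_of_range_le {I p : Ideal R} (s : I →ₗ[R] R) (hs : Function.Injective s)
    (hp : p ∈ minimalPrimes R) (h : LinearMap.range s ≤ p) : I ≤ p := by
  have := hp.1.1
  intro w hw
  let v : I := ⟨w, hw⟩
  obtain ⟨t, ht, k, hk⟩ := exists_mul_pow_eq_zero_of_mem_minimalPrimes hp (h ⟨v, rfl⟩)
  have key : ∀ j a, a * s v ^ j = 0 → a * w ^ j = 0 := by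
    intro j
    induction j with
    | zero => simp
    | succ j ih =>
      intro a ha
      have h1 : (a * s v ^ j) • v = 0 := hs (by
        rw [map_smul, map_zero, smul_eq_mul, mul_assoc, ← pow_succ, ha])
      have h2 : a * s v ^ j * w = 0 := congrArg Subtype.val h1
      rw [pow_succ', ← mul_assoc]
      exact ih _ (by rw [mul_right_comm, h2])
  exact this.mem_of_pow_mem k
    ((this.mem_or_mem (x := t) (by rw [key k t hk]; exact p.zero_mem)).resolve_left ht)

lemma ringKrullDim_quotient_range_le {I : Ideal R} (s : I →ₗ[R] R) (hs : Function.Injective s)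
    (m : ℕ) (hR : ringKrullDim R ≤ (m + 1 : ℕ)) (hRI : ringKrullDim (R ⧸ I) ≤ m) :
    ringKrullDim (R ⧸ (LinearMap.range s : Ideal R)) ≤ m := by
  rw [ringKrullDim_quotient] at hRI ⊢
  refine iSup_le fun l ↦ ?_
  obtain ⟨p, hp, hpl⟩ := Ideal.exists_minimalPrimes_le (J := l.head.1.asIdeal) bot_le
  let p' : PrimeSpectrum R := ⟨p, hp.1.1⟩
  rcases (show p' ≤ l.head.1 from hpl).lt_or_eq with hlt | heq
  · let q : LTSeries (PrimeSpectrum R) := (l.map Subtype.val (fun _ _ ↦ id)).cons p' hlt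
    have hq : q.length = l.length + 1 := by
      change 0 + l.length + 1 = _
      omega
    have h : (q.length : WithBot ℕ∞) ≤ (m + 1 : ℕ) :=
      (Order.LTSeries.length_le_krullDim q).trans hR
    rw [hq, Nat.cast_le] at h
    exact Nat.cast_le.2 (Nat.le_of_succ_le_succ h)
  · have hIp : I ≤ p := le_minimalPrime_of_range_le s hs hp (by
      have := l.head.2
      rwa [← heq] at this)
    let l' : LTSeries (PrimeSpectrum.zeroLocus (R := R) I) :=
      { length := l.length
        toFun := fun i ↦ ⟨(l i).1, fun a ha ↦ (l.head_le i : l.head.1 ≤ _) (hpl (hIp ha))⟩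
        step := l.step }
    exact (Order.LTSeries.length_le_krullDim l').trans hRI

lemma HasRegularSequence.of_ringDepth_eq {A : Type} [CommRing A] [IsLocalRing A]
    [IsNoetherianRing A] {m : ℕ} (h : ringDepth A = m) :
    HasRegularSequence A A m := by
  refine (forall_subsingleton_ext_residueField_iff (ModuleCat.of A A) m).1 fun i hi ↦
    (subsingleton_extMod_iff _ _ i).1 ?_
  by_contra hi'
  exact Nat.notMem_of_lt_sInf (hi.trans_eq h.symm) hi'

lemma HasRegularSequence.isCohenMacaulayLocalOfDim {A : Type} [CommRing A]
    [IsLocalRing A] [IsNoetherianRing A] {m : ℕ} (hreg : HasRegularSequence A A m)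
    (hdim : ringKrullDim A ≤ m) : IsCohenMacaulayLocalOfDim A m := by
  have hle : ∀ k : ℕ, HasRegularSequence A A k → (k : WithBot ℕ∞) ≤ ringKrullDim A := by
    rintro _ ⟨rs, rfl, hm, hr⟩
    have hr := IsRegular.of_isWeaklyRegular_of_mem_maximalIdeal _ hm hr
    have : Nontrivial (A ⧸ Ideal.ofList rs) := Ideal.Quotient.nontrivial_iff.2
      (ne_top_of_le_ne_top (maximalIdeal.isMaximal A).ne_top (Ideal.span_le.2 hm))
    rw [← ringKrullDim_add_length_eq_ringKrullDim_of_isRegular rs hr]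
    exact le_add_of_nonneg_left ringKrullDim_nonneg_of_nontrivial
  have hlt : ∀ i < m, Subsingleton (extMod A i (ModuleCat.of A (ResidueField A))
      (ModuleCat.of A A)) := fun i hi ↦
    (subsingleton_extMod_iff _ _ i).2
      ((forall_subsingleton_ext_residueField_iff (ModuleCat.of A A) m).2 hreg i hi)
  have hmem : ¬ Subsingleton (extMod A m (ModuleCat.of A (ResidueField A)) (ModuleCat.of A A)) := by
    intro h
    have hext : ∀ i < m + 1, Subsingleton
        (Abelian.Ext (ModuleCat.of A (ResidueField A)) (ModuleCat.of A A) i) := fun i hi ↦ by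
      rw [← subsingleton_extMod_iff]
      rcases (Nat.lt_succ_iff.1 hi).lt_or_eq with hi | rfl
      exacts [hlt i hi, h]
    have hm := (hle (m + 1)
      ((forall_subsingleton_ext_residueField_iff (ModuleCat.of A A) _).1 hext)).trans hdim
    exact Nat.not_succ_le_self m (Nat.cast_le.1 hm)
  refine ⟨inferInstance, hdim.antisymm (hle m hreg), (Nat.sInf_le hmem).antisymm ?_⟩
  refine le_csInf ⟨m, hmem⟩ fun i hi ↦ ?_
  by_contra! hlt'
  exact hi (hlt i hlt')

lemma subsingleton_ext_left_of_shortExact (K : ModuleCat.{0} R)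
    {S : ShortComplex (ModuleCat.{0} R)} (hS : S.ShortExact) {m : ℕ}
    (h₂ : ∀ i < m + 1, Subsingleton (Abelian.Ext K S.X₂ i))
    (h₃ : ∀ i < m, Subsingleton (Abelian.Ext K S.X₃ i)) :
    ∀ i < m + 1, Subsingleton (Abelian.Ext K S.X₁ i) := by
  intro i hi
  cases i with
  | zero =>
    have := Abelian.Ext.addEquiv₀.subsingleton_congr.1 (h₂ 0 hi)
    rw [Abelian.Ext.addEquiv₀.subsingleton_congr]
    have := hS.mono_f
    exact ⟨fun a b ↦ (cancel_mono S.f).1 (Subsingleton.elim _ _)⟩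
  | succ i =>
    exact AddCommGrpCat.subsingleton_of_isZero <| ShortComplex.Exact.isZero_of_both_zeros
      (Abelian.Ext.covariant_sequence_exact₁' K hS i (i + 1) rfl)
      ((AddCommGrpCat.isZero_of_iff_subsingleton.mpr (h₃ i (by omega))).eq_zero_of_src _)
      ((AddCommGrpCat.isZero_of_iff_subsingleton.mpr (h₂ (i + 1) hi)).eq_zero_of_tgt _)

lemma subsingleton_ext_right_of_shortExact (K : ModuleCat.{0} R)
    {S : ShortComplex (ModuleCat.{0} R)} (hS : S.ShortExact) {m : ℕ}
    (h₁ : ∀ i < m + 1, Subsingleton (Abelian.Ext K S.X₁ i))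
    (h₂ : ∀ i < m, Subsingleton (Abelian.Ext K S.X₂ i)) :
    ∀ i < m, Subsingleton (Abelian.Ext K S.X₃ i) := fun i hi ↦
  AddCommGrpCat.subsingleton_of_isZero <| ShortComplex.Exact.isZero_of_both_zeros
    (Abelian.Ext.covariant_sequence_exact₃' K hS i (i + 1) rfl)
    ((AddCommGrpCat.isZero_of_iff_subsingleton.mpr (h₂ i hi)).eq_zero_of_src _)
    ((AddCommGrpCat.isZero_of_iff_subsingleton.mpr (h₁ (i + 1) (by omega))).eq_zero_of_tgt _)

end

/-- In the unprojection setup (`R` Noetherian Gorenstein local of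
dimension `n`, `I` proper with `R/I` Gorenstein local of dimension `n - 1`), let `s : I → R`
be injective with class generating `Ext¹_R(R/I, R) ≅ Hom_R(I,R)/(R·ι)` as an `R/I`-module,
set `J = s(I)`, and assume `I` is not principal.  Then `R/J` is a Cohen--Macaulay local ring
of Krull dimension `n - 1`. -/
theorem numerator_quotient_isCohenMacaulay (R : Type) [CommRing R] [IsLocalRing R] (n : ℕ)
    (hn : 0 < n) (I : Ideal R) (hI : I ≠ ⊤) [IsLocalRing (R ⧸ I)]
    (hGR : IsGorensteinLocalOfDim R n)
    (hGRI : IsGorensteinLocalOfDim (R ⧸ I) (n - 1))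
    (s : I →ₗ[R] R) (hs : Function.Injective s)
    (hgen : Submodule.span R
      {(Submodule.Quotient.mk s :
          (I →ₗ[R] R) ⧸ Submodule.span R {Submodule.subtype I})} = ⊤)
    (hnp : ¬ I.IsPrincipal) :
    ∃ h : IsLocalRing (R ⧸ (LinearMap.range s : Ideal R)),
      @IsCohenMacaulayLocalOfDim (R ⧸ (LinearMap.range s : Ideal R)) _ h (n - 1) := by
  obtain ⟨m, rfl⟩ : ∃ m, n = m + 1 := ⟨n - 1, by omega⟩
  rw [Nat.add_sub_cancel] at hGRI ⊢
  obtain ⟨hNR, hdR, hR, -⟩ := hGR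
  obtain ⟨-, hdRI, hRI, -⟩ := hGRI
  have hJ : (LinearMap.range s : Ideal R) ≠ ⊤ := by
    intro h
    let e := LinearEquiv.ofBijective s ⟨hs, LinearMap.range_eq_top.1 h⟩
    refine hnp ⟨(e.symm 1 : I), le_antisymm (fun x hx ↦ ?_) ?_⟩
    · refine Submodule.mem_span_singleton.2 ⟨e ⟨x, hx⟩, ?_⟩
      rw [← Submodule.coe_smul, ← map_smul, smul_eq_mul, mul_one, e.symm_apply_apply]
    · simp [Submodule.span_le]
  have : Nontrivial (R ⧸ (LinearMap.range s : Ideal R)) := Ideal.Quotient.nontrivial_iff.2 hJ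
  have hloc : IsLocalRing (R ⧸ (LinearMap.range s : Ideal R)) :=
    .of_surjective' (Ideal.Quotient.mk _) Ideal.Quotient.mk_surjective
  refine ⟨hloc, HasRegularSequence.isCohenMacaulayLocalOfDim ?_
    (ringKrullDim_quotient_range_le s hs m hdR.le hdRI.le)⟩
  have hER := (forall_subsingleton_ext_residueField_iff (ModuleCat.of R R) _).2
    (HasRegularSequence.of_ringDepth_eq hR)
  have hERI := (forall_subsingleton_ext_residueField_iff (ModuleCat.of R (R ⧸ I)) _).2
    ((hasRegularSequence_iff_of_surjective Ideal.Quotient.mk_surjective (R ⧸ I) m).2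
      (HasRegularSequence.of_ringDepth_eq hRI))
  let S₁ := ShortComplex.mk (ModuleCat.ofHom I.subtype) (ModuleCat.ofHom I.mkQ)
    (ModuleCat.hom_ext (LinearMap.exact_subtype_mkQ I).linearMap_comp_eq_zero)
  have hS₁ : S₁.ShortExact := ModuleCat.shortComplex_shortExact _
    (LinearMap.exact_subtype_mkQ I) I.injective_subtype I.mkQ_surjective
  let S₂ := ShortComplex.mk (ModuleCat.ofHom s) (ModuleCat.ofHom (LinearMap.range s).mkQ)
    (ModuleCat.hom_ext (LinearMap.exact_map_mkQ_range s).linearMap_comp_eq_zero)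
  have hS₂ : S₂.ShortExact := ModuleCat.shortComplex_shortExact _
    (LinearMap.exact_map_mkQ_range s) hs (Submodule.mkQ_surjective _)
  refine (hasRegularSequence_iff_of_surjective Ideal.Quotient.mk_surjective _ m).1
    ((forall_subsingleton_ext_residueField_iff (ModuleCat.of R (R ⧸ LinearMap.range s)) m).1 ?_)
  exact subsingleton_ext_right_of_shortExact _ hS₂
    (subsingleton_ext_left_of_shortExact _ hS₁ hER hERI) fun i hi ↦ hER i (by omega)
end

section
/- Let s : I → R be an injective R-module homomorphism whose class generates Ext¹_R(R/I, R) as an R/I-module, set J = s(I), and let t = s⁻¹ : J → I ⊆ R, viewed as an element of Hom_R(J, R). Then the dual map s* : Hom_R(J, R) → Hom_R(I, R), φ ↦ φ ∘ s, is an isomorphism of R-modules sending the inclusion ι_J : J → R to s and sending t to ι. Consequently Hom_R(J, R) is generated as an R-module by the two elements ι_J and t. -/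
open CategoryTheory

/-- The inverse `t = s⁻¹ : J → I ⊆ R` of an injective homomorphism `s : I → R` with image
`J = s(I)`, viewed as an element of `Hom_R(J, R)`. -/
noncomputable def inverseHom (R : Type) [CommRing R] (I : Ideal R) (s : I →ₗ[R] R)
    (hs : Function.Injective s) : (LinearMap.range s : Ideal R) →ₗ[R] R :=
  (Submodule.subtype I).comp (LinearEquiv.ofInjective s hs).symm.toLinearMap

/-- If the class of `x` generates `M ⧸ R y`, then `x` and `y` generate `M`. -/
theorem span_pair_eq_top_of_span_mk_eq_top {R M : Type*} [CommRing R] [AddCommGroup M]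
    [Module R M] (x y : M)
    (h : Submodule.span R {(Submodule.Quotient.mk x : M ⧸ Submodule.span R {y})} = ⊤) :
    Submodule.span R {x, y} = ⊤ := by
  have hmap : (Submodule.span R {x}).map (Submodule.span R {y}).mkQ = ⊤ := by
    rw [Submodule.map_span, Set.image_singleton]
    exact h
  rw [Submodule.map_mkQ_eq_top] at hmap
  rw [Submodule.span_insert, sup_comm]
  exact hmap

/-- In the unprojection setup, let `s : I → R` be injective with class
generating `Ext¹_R(R/I, R)` as an `R/I`-module, `J = s(I)`, and `t = s⁻¹ : J → R`.  Then the
dual map `s* : Hom_R(J, R) → Hom_R(I, R)`, `φ ↦ φ ∘ s`, is an isomorphism of `R`-modules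
sending the inclusion `ι_J` to `s` and `t` to `ι`.  Consequently `Hom_R(J, R)` is generated
as an `R`-module by `ι_J` and `t`. -/
theorem dual_hom_module_generators (R : Type) [CommRing R] [IsLocalRing R] (n : ℕ)
    (hn : 0 < n) (I : Ideal R) (hI : I ≠ ⊤) [IsLocalRing (R ⧸ I)]
    (hGR : IsGorensteinLocalOfDim R n)
    (hGRI : IsGorensteinLocalOfDim (R ⧸ I) (n - 1))
    (s : I →ₗ[R] R) (hs : Function.Injective s)
    (hgen : Submodule.span R
      {(Submodule.Quotient.mk s :
          (I →ₗ[R] R) ⧸ Submodule.span R {Submodule.subtype I})} = ⊤) :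
    Function.Bijective (LinearMap.lcomp R R s.rangeRestrict :
      ((LinearMap.range s : Ideal R) →ₗ[R] R) →ₗ[R] (I →ₗ[R] R)) ∧
    LinearMap.lcomp R R s.rangeRestrict
      (Submodule.subtype (LinearMap.range s : Ideal R)) = s ∧
    LinearMap.lcomp R R s.rangeRestrict (inverseHom R I s hs) = Submodule.subtype I ∧
    Submodule.span R
      {Submodule.subtype (LinearMap.range s : Ideal R), inverseHom R I s hs} = ⊤ := by
  set e : I ≃ₗ[R] LinearMap.range s := LinearEquiv.ofInjective s hs
  have he : s.rangeRestrict = e.toLinearMap := by ext x; rfl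
  have hbij : Function.Bijective (LinearMap.lcomp R R s.rangeRestrict :
      ((LinearMap.range s : Ideal R) →ₗ[R] R) →ₗ[R] (I →ₗ[R] R)) := by
    rw [he]
    exact (e.congrLeft R R).symm.bijective
  have hι : LinearMap.lcomp R R s.rangeRestrict
      (Submodule.subtype (LinearMap.range s : Ideal R)) = s := by
    ext x; rfl
  have ht : LinearMap.lcomp R R s.rangeRestrict (inverseHom R I s hs) =
      Submodule.subtype I := by
    ext x
    exact congrArg Subtype.val (e.symm_apply_apply x)
  refine ⟨hbij, hι, ht, Submodule.map_injective_of_injective hbij.1 ?_⟩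
  rw [Submodule.map_span, Set.image_pair, hι, ht, Submodule.map_top,
    LinearMap.range_eq_top.mpr hbij.2]
  exact span_pair_eq_top_of_span_mk_eq_top _ _ hgen
end
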